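/- arXiv:2003.03886 — 7 statements merged into one kernel-verified Lean document; each statement's English description precedes it below -/
import Mathlib

section
/- For every integer k ≥ 1, the k-th order discrete integral operator S^k_n is the two-sided inverse of the k-th order discrete derivative operator Δ^k_n: for every function f on [a,b], Δ^k_n(S^k_n f) = f and S^k_n(Δ^k_n f) = f. -/
open Finset

/-- Divided difference of `f` with respect to a list of centers:
`f[z] = f z`, and `f[z₁,…,z_{r+1}] = (f[z₂,…,z_{r+1}] − f[z₁,…,z_r]) / (z_{r+1} − z₁)`. -/
noncomputable def divDiff (f : ℝ → ℝ) : List ℝ → ℝ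
  | [] => 0
  | [z] => f z
  | z :: y :: l =>
      (divDiff f (y :: l) - divDiff f (z :: (y :: l).dropLast)) /
        ((y :: l).getLast (List.cons_ne_nil y l) - z)
  termination_by l => l.length
  decreasing_by
  · simp
  · simp [List.length_dropLast]

/-- The list of centers `x_lo, …, x_hi`. -/
noncomputable def ctrs (x : ℕ → ℝ) (lo hi : ℕ) : List ℝ :=
  (List.range (hi + 1 - lo)).map fun m => x (lo + m)

/-- The index `i` such that `t ∈ (x_i, x_{i+1}]` (equals `0` when `t ≤ x 1`,
and `n` when `t > x n`): the number of design points strictly below `t`. -/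
noncomputable def discrIdx (x : ℕ → ℝ) (n : ℕ) (t : ℝ) : ℕ :=
  ((Finset.Icc 1 n).filter fun i => x i < t).card

/-- The `k`-th order discrete derivative operator `Δ^k_n`:
for `t ∈ (x_i, x_{i+1}]` with `i ≥ k` it is `k!·f[x_{i−k+1},…,x_i,t]`,
for `t ∈ (x_i, x_{i+1}]` with `i < k` it is `i!·f[x_1,…,x_i,t]`,
and for `t ≤ x_1` it is `f t`; `Δ^0_n` is the identity. -/
noncomputable def discreteDeriv (x : ℕ → ℝ) (n k : ℕ) (f : ℝ → ℝ) (t : ℝ) : ℝ :=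
  let i := discrIdx x n t
  if k ≤ i then (Nat.factorial k : ℝ) * divDiff f (ctrs x (i + 1 - k) i ++ [t])
  else (Nat.factorial i : ℝ) * divDiff f (ctrs x 1 i ++ [t])

/-- The simple cumulative sum operator `S̄(·; x_{lo:n})`:
for `t ∈ (x_i, x_{i+1}]` it is `Σ_{j=lo}^i f(x_j) + f(t)`, and `f t` for `t ≤ x_lo`. -/
noncomputable def cumSum (x : ℕ → ℝ) (lo n : ℕ) (f : ℝ → ℝ) (t : ℝ) : ℝ :=
  (∑ j ∈ Finset.Icc lo n, if x j < t then f (x j) else 0) + f t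

/-- The weight map `W^k_n`. -/
noncomputable def weightMap (x : ℕ → ℝ) (n k : ℕ) (f : ℝ → ℝ) (t : ℝ) : ℝ :=
  let i := discrIdx x n t
  if k ≤ i then f t * ((t - x (i + 1 - k)) / k) else f t

/-- The `k`-th order discrete integral operator `S^k_n`:
`S^0 = id`, `S^1 = S̄(·;x_{1:n}) ∘ W^1_n`, and `S^k = S^{k-1} ∘ S̄(·;x_{k:n}) ∘ W^k_n`. -/
noncomputable def discreteInteg (x : ℕ → ℝ) (n : ℕ) : ℕ → (ℝ → ℝ) → ℝ → ℝ
  | 0, f => f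
  | k + 1, f => discreteInteg x n k (cumSum x (k + 1) n (weightMap x n (k + 1) f))

theorem divDiff_concat (f : ℝ → ℝ) (z w : ℝ) (l : List ℝ) :
    divDiff f (z :: (l ++ [w])) = (divDiff f (l ++ [w]) - divDiff f (z :: l)) / (w - z) := by
  obtain ⟨y, l', h⟩ : ∃ y l', l ++ [w] = y :: l' := by
    cases l with
    | nil => exact ⟨w, [], rfl⟩
    | cons y l => exact ⟨y, l ++ [w], rfl⟩
  have h1 : (y :: l').getLast (List.cons_ne_nil y l') = w := by simp [← h]
  have h2 : (y :: l').dropLast = l := by simp [← h]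
  rw [h, divDiff, h1, h2]

theorem ctrs_cons (x : ℕ → ℝ) (lo hi : ℕ) (h : lo ≤ hi) :
    ctrs x lo hi = x lo :: ctrs x (lo + 1) hi := by
  unfold ctrs
  rw [show hi + 1 - lo = (hi + 1 - (lo + 1)) + 1 by omega, List.range_succ_eq_map]
  simp only [List.map_cons, List.map_map, Nat.add_zero]
  congr 1
  apply List.map_congr_left
  intro a _
  simp only [Function.comp]
  congr 1
  omega

theorem ctrs_snoc (x : ℕ → ℝ) (lo hi : ℕ) (h : lo ≤ hi + 1) :
    ctrs x lo (hi + 1) = ctrs x lo hi ++ [x (hi + 1)] := by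
  unfold ctrs
  rw [show hi + 1 + 1 - lo = (hi + 1 - lo) + 1 by omega, List.range_succ]
  simp only [List.map_append, List.map_cons, List.map_nil]
  rw [show lo + (hi + 1 - lo) = hi + 1 by omega]

theorem x_lt (n : ℕ) (x : ℕ → ℝ) (hmono : ∀ i, 1 ≤ i → i < n → x i < x (i + 1))
    (i j : ℕ) (hi : 1 ≤ i) (hij : i < j) (hj : j ≤ n) : x i < x j := by
  induction j with
  | zero => omega
  | succ j ih =>
    rcases Nat.lt_or_ge i j with h | h
    · exact (ih h (by omega)).trans (hmono j (by omega) (by omega))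
    · obtain rfl : i = j := by omega
      exact hmono i hi (by omega)

theorem idx_le (n : ℕ) (x : ℕ → ℝ) (t : ℝ) : discrIdx x n t ≤ n := by
  unfold discrIdx
  refine (Finset.card_filter_le _ _).trans ?_
  simp

theorem lt_iff_idx (n : ℕ) (x : ℕ → ℝ) (hmono : ∀ i, 1 ≤ i → i < n → x i < x (i + 1))
    (t : ℝ) (j : ℕ) (h1 : 1 ≤ j) (hj : j ≤ n) : x j < t ↔ j ≤ discrIdx x n t := by
  unfold discrIdx
  constructor
  · intro h
    have : Finset.Icc 1 j ⊆ (Finset.Icc 1 n).filter fun i => x i < t := by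
      intro i hi
      simp only [Finset.mem_Icc, Finset.mem_filter] at hi ⊢
      refine ⟨by omega, ?_⟩
      rcases hi.2.lt_or_eq with h' | h'
      · exact (x_lt n x hmono i j hi.1 h' hj).trans h
      · rwa [h']
    simpa using Finset.card_le_card this
  · intro h
    by_contra hc
    have : ((Finset.Icc 1 n).filter fun i => x i < t) ⊆ Finset.Icc 1 (j - 1) := by
      intro i hi
      simp only [Finset.mem_Icc, Finset.mem_filter] at hi ⊢
      refine ⟨by omega, ?_⟩
      by_contra h'
      rcases (show j ≤ i by omega).lt_or_eq with h'' | h''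
      · exact hc ((x_lt n x hmono j i h1 h'' hi.1.2).trans hi.2)
      · exact hc (h'' ▸ hi.2)
    have := Finset.card_le_card this
    simp only [Nat.card_Icc] at this
    omega

theorem idx_x (n : ℕ) (x : ℕ → ℝ) (hmono : ∀ i, 1 ≤ i → i < n → x i < x (i + 1))
    (j : ℕ) (hj : j + 1 ≤ n) : discrIdx x n (x (j + 1)) = j := by
  apply le_antisymm
  · have := lt_iff_idx n x hmono (x (j + 1)) (j + 1) (by omega) hj
    simp only [lt_self_iff_false, false_iff] at this
    omega
  · rcases Nat.eq_zero_or_pos j with h | h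
    · omega
    · exact (lt_iff_idx n x hmono (x (j + 1)) j h (by omega)).1 (hmono j h (by omega))

theorem cumSum_eq (n : ℕ) (x : ℕ → ℝ) (hmono : ∀ i, 1 ≤ i → i < n → x i < x (i + 1))
    (k : ℕ) (g : ℝ → ℝ) (t : ℝ) :
    cumSum x (k + 1) n g t = (∑ j ∈ Finset.Icc (k + 1) (discrIdx x n t), g (x j)) + g t := by
  unfold cumSum
  rw [← Finset.sum_filter]
  congr 2
  ext j
  have := idx_le n x t
  simp only [Finset.mem_Icc, Finset.mem_filter]
  constructor
  · rintro ⟨h, h'⟩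
    exact ⟨h.1, (lt_iff_idx n x hmono t j (by omega) h.2).1 h'⟩
  · rintro ⟨h, h'⟩
    exact ⟨by omega, (lt_iff_idx n x hmono t j (by omega) (by omega)).2 h'⟩

theorem weight_low (n k : ℕ) (x : ℕ → ℝ) (f : ℝ → ℝ) (t : ℝ) (h : discrIdx x n t < k + 1) :
    weightMap x n (k + 1) (discreteDeriv x n (k + 1) f) t = discreteDeriv x n k f t := by
  simp only [weightMap, discreteDeriv]
  rw [if_neg (by omega), if_neg (by omega)]
  split_ifs with h'
  · have : discrIdx x n t = k := by omega
    rw [this, show k + 1 - k = 1 by omega]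
  · rfl

theorem weight_high (n : ℕ) (x : ℕ → ℝ) (hmono : ∀ i, 1 ≤ i → i < n → x i < x (i + 1))
    (k : ℕ) (f : ℝ → ℝ) (t : ℝ) (i : ℕ) (hi : discrIdx x n t = i + 1) (h : k + 1 ≤ i + 1) :
    weightMap x n (k + 1) (discreteDeriv x n (k + 1) f) t =
      discreteDeriv x n k f t - discreteDeriv x n k f (x (i + 1)) := by
  have hin := idx_le n x t
  have hx := idx_x n x hmono i (by omega)
  have hlt : x (i + 1 - k) < t := (lt_iff_idx n x hmono t _ (by omega) (by omega)).2 (by omega)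
  simp only [weightMap, discreteDeriv]
  rw [hx, hi, if_pos h, if_pos h, if_pos (by omega), if_pos (by omega)]
  rw [show i + 1 + 1 - (k + 1) = i + 1 - k by omega, ctrs_cons x (i + 1 - k) (i + 1) (by omega),
    List.cons_append, divDiff_concat, ← ctrs_cons x (i + 1 - k) (i + 1) (by omega),
    ctrs_snoc x (i + 1 - k) i (by omega), show i + 1 - k + 1 = i + 1 + 1 - k by omega]
  have h1 : t - x (i + 1 - k) ≠ 0 := (sub_pos.2 hlt).ne'
  have h2 : ((k : ℝ) + 1) ≠ 0 := by positivity
  rw [Nat.factorial_succ]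
  push_cast
  field_simp

theorem step (n : ℕ) (x : ℕ → ℝ) (hmono : ∀ i, 1 ≤ i → i < n → x i < x (i + 1))
    (k : ℕ) (f : ℝ → ℝ) :
    cumSum x (k + 1) n (weightMap x n (k + 1) (discreteDeriv x n (k + 1) f)) =
      discreteDeriv x n k f := by
  have key : ∀ m, k ≤ m → m + 1 ≤ n → ∑ j ∈ Finset.Icc (k + 1) (m + 1),
      weightMap x n (k + 1) (discreteDeriv x n (k + 1) f) (x j) =
        discreteDeriv x n k f (x (m + 1)) := by
    intro m hm
    induction m, hm using Nat.le_induction with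
    | base =>
      intro hn
      rw [Finset.Icc_self, Finset.sum_singleton]
      exact weight_low n k x f _ (by rw [idx_x n x hmono k hn]; omega)
    | succ m hm ih =>
      intro hn
      rw [Finset.sum_Icc_succ_top (by omega), ih (by omega),
        weight_high n x hmono k f _ m (idx_x n x hmono (m + 1) hn) (by omega)]
      ring
  funext t
  rw [cumSum_eq n x hmono]
  rcases Nat.lt_or_ge (discrIdx x n t) (k + 1) with h | h
  · rw [Finset.Icc_eq_empty (by omega), Finset.sum_empty, zero_add, weight_low n k x f t h]
  · obtain ⟨i, hi⟩ : ∃ i, discrIdx x n t = i + 1 := ⟨discrIdx x n t - 1, by omega⟩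
    have := idx_le n x t
    rw [hi, key i (by omega) (by omega), weight_high n x hmono k f t i hi (by omega)]
    ring

theorem integ_deriv (n : ℕ) (x : ℕ → ℝ) (hmono : ∀ i, 1 ≤ i → i < n → x i < x (i + 1))
    (k : ℕ) (f : ℝ → ℝ) : discreteInteg x n k (discreteDeriv x n k f) = f := by
  induction k with
  | zero =>
    funext t
    simp [discreteInteg, discreteDeriv, ctrs, divDiff]
  | succ k ih => rw [discreteInteg, step n x hmono, ih]

theorem cumSum_inj (n : ℕ) (x : ℕ → ℝ) (hmono : ∀ i, 1 ≤ i → i < n → x i < x (i + 1))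
    (k : ℕ) (f g : ℝ → ℝ) (h : cumSum x (k + 1) n f = cumSum x (k + 1) n g) : f = g := by
  have main : ∀ i t, discrIdx x n t = i → f t = g t := by
    intro i
    induction i using Nat.strong_induction_on with
    | _ i ih =>
      intro t ht
      have h1 := congrFun h t
      have hn := idx_le n x t
      rw [cumSum_eq n x hmono, cumSum_eq n x hmono, ht] at h1
      have : ∑ j ∈ Finset.Icc (k + 1) i, f (x j) = ∑ j ∈ Finset.Icc (k + 1) i, g (x j) := by
        apply Finset.sum_congr rfl
        intro j hj
        rw [Finset.mem_Icc] at hj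
        obtain ⟨m, rfl⟩ : ∃ m, j = m + 1 := ⟨j - 1, by omega⟩
        exact ih m (by omega) _ (idx_x n x hmono m (by omega))
      linarith
  funext t
  exact main _ t rfl

theorem weight_inj (n : ℕ) (x : ℕ → ℝ) (hmono : ∀ i, 1 ≤ i → i < n → x i < x (i + 1))
    (k : ℕ) (f g : ℝ → ℝ) (h : weightMap x n (k + 1) f = weightMap x n (k + 1) g) : f = g := by
  funext t
  have h1 := congrFun h t
  have hin := idx_le n x t
  simp only [weightMap] at h1
  split_ifs at h1 with hk
  · have hlt : x (discrIdx x n t + 1 - (k + 1)) < t :=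
      (lt_iff_idx n x hmono t _ (by omega) (by omega)).2 (by omega)
    refine mul_right_cancel₀ (div_ne_zero (sub_pos.2 hlt).ne' ?_) h1
    exact Nat.cast_ne_zero.2 (by omega)
  · exact h1

theorem integ_inj (n : ℕ) (x : ℕ → ℝ) (hmono : ∀ i, 1 ≤ i → i < n → x i < x (i + 1))
    (k : ℕ) (f g : ℝ → ℝ) (h : discreteInteg x n k f = discreteInteg x n k g) : f = g := by
  induction k generalizing f g with
  | zero => exact h
  | succ k ih =>
    exact weight_inj n x hmono k f g (cumSum_inj n x hmono k _ _ (ih _ _ h))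

/-- Lemma: inverse relationship between discrete differentiation and
discrete integration. For every `k ≥ 1` and every function `f` on `[a,b]`,
`Δ^k_n (S^k_n f) = f` and `S^k_n (Δ^k_n f) = f` on `[a,b]`. -/
theorem discreteDeriv_discreteInteg_inverse
    (n k : ℕ) (a b : ℝ) (x : ℕ → ℝ)
    (hn : 1 ≤ n) (hk : 1 ≤ k)
    (hmono : ∀ i, 1 ≤ i → i < n → x i < x (i + 1))
    (ha : a ≤ x 1) (hb : x n ≤ b) (hab : x (n + 1) = b)
    (f : ℝ → ℝ) :
    (∀ t ∈ Set.Icc a b, discreteDeriv x n k (discreteInteg x n k f) t = f t) ∧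
    (∀ t ∈ Set.Icc a b, discreteInteg x n k (discreteDeriv x n k f) t = f t) := by
  have h := integ_deriv n x hmono k
  exact ⟨fun t _ => congrFun (integ_inj n x hmono k _ _ (h (discreteInteg x n k f))) t,
    fun t _ => congrFun (h f) t⟩
end

section
/- Let k ≥ 0 and n ≥ k+2. For each j = k+2, …, n and all x ∈ [a,b]: (1/k!)·∏_{ℓ=j−k}^{j−1}(x − x_ℓ)·1{x > x_{j−1}} = (S^k_n 1_{x_{j−1}})(x), where 1_t denotes the step function 1_t(x) = 1{x > t} and S^0_n is the identity. Equivalently, (Δ^k_n h^k_j)(x) = 1{x > x_{j−1}} for all x ∈ [a,b] and each j = k+2, …, n. -/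
open Finset

/-- The `k`-th degree falling factorial basis function `h^k_j`. -/
noncomputable def fallFact (x : ℕ → ℝ) (k j : ℕ) (t : ℝ) : ℝ :=
  if j ≤ k + 1 then
    (1 / (Nat.factorial (j - 1) : ℝ)) * ∏ ℓ ∈ Finset.Icc 1 (j - 1), (t - x ℓ)
  else
    (1 / (Nat.factorial k : ℝ)) * (∏ ℓ ∈ Finset.Icc (j - k) (j - 1), (t - x ℓ)) *
      (if x (j - 1) < t then 1 else 0)

/-- Membership in `H^k_n`, the span of the falling factorial basis, as functions on `[a,b]`. -/
def inFFSpan (x : ℕ → ℝ) (n k : ℕ) (a b : ℝ) (f : ℝ → ℝ) : Prop :=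
  ∃ c : ℕ → ℝ, ∀ t ∈ Set.Icc a b, f t = ∑ j ∈ Finset.Icc 1 n, c j * fallFact x k j t

/-- Divided difference of data `v_lo, …, v_{lo+d}` over centers `x_lo, …, x_{lo+d}`. -/
noncomputable def divDiffVec (x v : ℕ → ℝ) : ℕ → ℕ → ℝ
  | lo, 0 => v lo
  | lo, d + 1 => (divDiffVec x v (lo + 1) d - divDiffVec x v lo d) / (x (lo + d + 1) - x lo)

/-- Left derivative. -/
noncomputable def lDeriv (f : ℝ → ℝ) : ℝ → ℝ := fun t => derivWithin f (Set.Iic t) t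

/-- `k`-th derivative, taken as the left derivative where the derivative does not exist. -/
noncomputable def Dk (m : ℕ) (f : ℝ → ℝ) : ℝ → ℝ := lDeriv^[m] f

lemma aux_dV_congr (z z' v v' : ℕ → ℝ) : ∀ (d lo : ℕ),
    (∀ m, lo ≤ m → m ≤ lo + d → z m = z' m) → (∀ m, lo ≤ m → m ≤ lo + d → v m = v' m) →
    divDiffVec z v lo d = divDiffVec z' v' lo d := by
  intro d
  induction d with
  | zero => intro lo _ h; simpa [divDiffVec] using h lo le_rfl le_rfl
  | succ d ih =>
    intro lo hz hv
    simp only [divDiffVec]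
    rw [ih (lo + 1) (fun m h1 h2 => hz m (by omega) (by omega)) (fun m h1 h2 => hv m (by omega) (by omega)),
      ih lo (fun m h1 h2 => hz m (by omega) (by omega)) (fun m h1 h2 => hv m (by omega) (by omega)),
      hz lo (by omega) (by omega), hz (lo + d + 1) (by omega) (by omega)]

lemma aux_dd_vec (f : ℝ → ℝ) (z : ℕ → ℝ) : ∀ (d lo : ℕ),
    divDiff f ((List.range (d + 1)).map fun m => z (lo + m)) =
      divDiffVec z (fun m => f (z m)) lo d := by
  intro d
  induction d with
  | zero => intro lo; simp [divDiff, divDiffVec]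
  | succ d ih =>
    intro lo
    have e1 : ((List.range (d + 1 + 1)).map fun m => z (lo + m)) =
        z lo :: ((List.range (d + 1)).map fun m => z (lo + 1 + m)) := by
      rw [List.range_succ_eq_map]
      simp only [List.map_cons, List.map_map, Nat.add_zero]
      congr 1
      apply List.map_congr_left
      intro m _
      simp only [Function.comp]
      congr 1
      simp only [Nat.succ_eq_add_one]; omega
    have e2 : ∀ L : List ℝ, (hL : L ≠ []) → divDiff f (z lo :: L) =
        (divDiff f L - divDiff f (z lo :: L.dropLast)) / (L.getLast hL - z lo) := by
      intro L hL
      cases L with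
      | nil => exact absurd rfl hL
      | cons y l => rw [divDiff]
    have e3 : ((List.range (d + 1)).map fun m => z (lo + 1 + m)).dropLast =
        ((List.range d).map fun m => z (lo + 1 + m)) := by
      rw [List.range_succ]; simp
    have e4 : z lo :: ((List.range d).map fun m => z (lo + 1 + m)) =
        ((List.range (d + 1)).map fun m => z (lo + m)) := by
      rw [List.range_succ_eq_map]
      simp only [List.map_cons, List.map_map, Nat.add_zero]
      congr 1
      apply List.map_congr_left
      intro m _
      simp only [Function.comp]
      congr 1
      simp only [Nat.succ_eq_add_one]; omega
    have hne : ((List.range (d + 1)).map fun m => z (lo + 1 + m)) ≠ [] := by simp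
    have e5 : ((List.range (d + 1)).map fun m => z (lo + 1 + m)).getLast hne = z (lo + d + 1) := by
      simp only [List.getLast_map, List.getLast_range]
      congr 1
      omega
    rw [e1, e2 _ hne, e3, e4, e5, ih, ih, divDiffVec]

lemma aux_leib (z v : ℕ → ℝ) (c : ℝ) : ∀ (d lo : ℕ),
    (∀ m m', lo ≤ m → m < m' → m' ≤ lo + (d + 1) → z m < z m') →
    divDiffVec z (fun m => (z m - c) * v m) lo (d + 1) =
      (z lo - c) * divDiffVec z v lo (d + 1) + divDiffVec z v (lo + 1) d := by
  intro d
  induction d with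
  | zero =>
    intro lo h
    have := h lo (lo + 1) le_rfl (by omega) (by omega)
    have h2 : z (lo + 1) - z lo ≠ 0 := (sub_pos.2 this).ne'
    simp only [divDiffVec, Nat.add_zero]
    field_simp
    ring
  | succ d ih =>
    intro lo h
    have h1 : z (lo + (d + 1) + 1) - z lo ≠ 0 :=
      (sub_pos.2 (h lo (lo + (d + 1) + 1) le_rfl (by omega) (by omega))).ne'
    have h2 : z (lo + 1 + d + 1) - z (lo + 1) ≠ 0 :=
      (sub_pos.2 (h (lo + 1) (lo + 1 + d + 1) (by omega) (by omega) (by omega))).ne'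
    rw [divDiffVec, ih (lo + 1) (fun m m' a b c => h m m' (by omega) b (by omega)),
      ih lo (fun m m' a b c => h m m' (by omega) b (by omega)),
      divDiffVec.eq_2 z v lo (d + 1)]
    have h3 : divDiffVec z v (lo + 1) (d + 1) * (z (lo + 1 + d + 1) - z (lo + 1)) =
        divDiffVec z v (lo + 1 + 1) d - divDiffVec z v (lo + 1) d := by
      rw [divDiffVec]; field_simp
    have e : lo + 1 + d + 1 = lo + (d + 1) + 1 := by omega
    rw [e] at h3
    field_simp
    linear_combination (-1 : ℝ) * h3

lemma aux_dV_smul (z v : ℕ → ℝ) (c : ℝ) : ∀ (d lo : ℕ),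
    divDiffVec z (fun m => c * v m) lo d = c * divDiffVec z v lo d := by
  intro d
  induction d with
  | zero => intro lo; simp [divDiffVec]
  | succ d ih => intro lo; simp only [divDiffVec, ih]; ring

lemma aux_dV_one (z : ℕ → ℝ) : ∀ (d lo : ℕ),
    divDiffVec z (fun _ => 1) lo (d + 1) = 0 := by
  intro d
  induction d with
  | zero => intro lo; simp [divDiffVec]
  | succ d ih => intro lo; rw [divDiffVec]; simp [ih]

lemma aux_dV_prod (z c : ℕ → ℝ) (s : Finset ℕ) : ∀ (d lo : ℕ),
    (∀ m m', lo ≤ m → m < m' → m' ≤ lo + d → z m < z m') → s.card ≤ d →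
    divDiffVec z (fun m => ∏ l ∈ s, (z m - c l)) lo d = if d = s.card then 1 else 0 := by
  induction s using Finset.induction_on with
  | empty =>
    intro d lo _ _
    cases d with
    | zero => simp [divDiffVec]
    | succ d => simp [aux_dV_one]
  | insert a s ha ih =>
    intro d lo h hd
    rw [Finset.card_insert_of_notMem ha] at hd ⊢
    obtain ⟨d, rfl⟩ : ∃ e, d = e + 1 := ⟨d - 1, by omega⟩
    simp only [Finset.prod_insert ha]
    rw [aux_leib z (fun m => ∏ l ∈ s, (z m - c l)) (c a) d lo h,
      ih (d + 1) lo h (by omega),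
      ih d (lo + 1) (fun m m' a b c => h m m' (by omega) b (by omega)) (by omega)]
    have : d + 1 ≠ s.card := by omega
    simp [this]

lemma aux_mono (n : ℕ) (x : ℕ → ℝ) (hmono : ∀ i, 1 ≤ i → i < n → x i < x (i + 1)) :
    ∀ m' m, 1 ≤ m → m < m' → m' ≤ n → x m < x m' := by
  intro m'
  induction m' with
  | zero => intro m _ h; omega
  | succ p ih =>
    intro m h1 h2 h3
    rcases Nat.lt_or_ge m p with h | h
    · exact (ih m h1 h (by omega)).trans (hmono p (by omega) (by omega))
    · have : m = p := by omega
      subst this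
      exact hmono m h1 (by omega)

lemma aux_idx_eq (n : ℕ) (x : ℕ → ℝ) (t : ℝ) (i : ℕ) (hi : i ≤ n)
    (h : ∀ l, 1 ≤ l → l ≤ n → (x l < t ↔ l ≤ i)) : discrIdx x n t = i := by
  unfold discrIdx
  have : (Finset.Icc 1 n).filter (fun i => x i < t) = Finset.Icc 1 i := by
    ext l
    simp only [Finset.mem_filter, Finset.mem_Icc]
    constructor
    · rintro ⟨⟨a, b⟩, c⟩; exact ⟨a, (h l a b).1 c⟩
    · rintro ⟨a, b⟩; exact ⟨⟨a, by omega⟩, (h l a (by omega)).2 b⟩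
  rw [this]; simp

lemma aux_idx_ex (n : ℕ) (x : ℕ → ℝ) (hx : ∀ m' m, 1 ≤ m → m < m' → m' ≤ n → x m < x m') (t : ℝ) :
    ∃ i ≤ n, ∀ l, 1 ≤ l → l ≤ n → (x l < t ↔ l ≤ i) := by
  classical
  refine ⟨Nat.findGreatest (fun l => 1 ≤ l ∧ x l < t) n, Nat.findGreatest_le n, ?_⟩
  intro l h1 h2
  constructor
  · intro h; exact Nat.le_findGreatest h2 ⟨h1, h⟩
  · intro h
    set g := Nat.findGreatest (fun l => 1 ≤ l ∧ x l < t) n with hg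
    have hs : 1 ≤ g ∧ x g < t := Nat.findGreatest_of_ne_zero hg.symm (by omega)
    rcases h.lt_or_eq with h' | h'
    · exact (hx g l h1 h' (Nat.findGreatest_le n)).trans hs.2
    · rw [h']; exact hs.2

lemma aux_ctrs (x : ℕ → ℝ) (t : ℝ) (d i : ℕ) (hd : d ≤ i) :
    ctrs x (i + 1 - d) i ++ [t] =
      (List.range (d + 1)).map fun m => (fun m => if m ≤ i then x m else t) (i + 1 - d + m) := by
  unfold ctrs
  have : i + 1 - (i + 1 - d) = d := by omega
  rw [this, List.range_succ, List.map_append]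
  congr 1
  · apply List.map_congr_left
    intro m hm
    have := List.mem_range.1 hm
    simp only
    rw [if_pos (by omega)]
  · simp only [List.map_cons, List.map_nil]
    rw [if_neg (by omega)]

lemma aux_deriv (n k : ℕ) (x : ℕ → ℝ) (f : ℝ → ℝ) (t : ℝ) (i : ℕ) (hi : discrIdx x n t = i) :
    discreteDeriv x n k f t = (Nat.factorial (min k i) : ℝ) *
      divDiffVec (fun m => if m ≤ i then x m else t)
        (fun m => f (if m ≤ i then x m else t)) (i + 1 - min k i) (min k i) := by
  unfold discreteDeriv
  simp only [hi]
  split_ifs with h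
  · rw [min_eq_left h, aux_ctrs x t k i h,
      aux_dd_vec f (fun m => if m ≤ i then x m else t)]
  · rw [min_eq_right (by omega)]
    have := aux_ctrs x t i i le_rfl
    rw [show i + 1 - i = 1 by omega] at *
    rw [this, aux_dd_vec f (fun m => if m ≤ i then x m else t)]

lemma aux_idx_pt (n : ℕ) (x : ℕ → ℝ) (hx : ∀ m' m, 1 ≤ m → m < m' → m' ≤ n → x m < x m')
    (i : ℕ) (h1 : 1 ≤ i) (h2 : i ≤ n) : discrIdx x n (x i) = i - 1 := by
  apply aux_idx_eq _ _ _ _ (by omega)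
  intro l hl hl'
  constructor
  · intro h
    by_contra hc
    rcases Nat.lt_or_ge i l with h' | h'
    · exact absurd (hx l i h1 h' hl') (not_lt.2 h.le)
    · have : l = i := by omega
      subst this; exact lt_irrefl _ h
  · intro h; exact hx i l hl (by omega) h2

lemma aux_weight_lo (n k : ℕ) (x : ℕ → ℝ) (f : ℝ → ℝ) (t : ℝ) (i : ℕ) (hi : discrIdx x n t = i)
    (hk : i ≤ k) :
    weightMap x n (k + 1) (discreteDeriv x n (k + 1) f) t = discreteDeriv x n k f t := by
  unfold weightMap
  simp only [hi]
  rw [if_neg (by omega), aux_deriv n _ x f t i hi, aux_deriv n _ x f t i hi,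
    min_eq_right (by omega), min_eq_right hk]

lemma aux_weight_hi (n k : ℕ) (x : ℕ → ℝ) (hx : ∀ m' m, 1 ≤ m → m < m' → m' ≤ n → x m < x m')
    (f : ℝ → ℝ) (t : ℝ) (i : ℕ) (hin : i ≤ n) (hi : discrIdx x n t = i) (hit : x i < t)
    (hk : k + 1 ≤ i) :
    weightMap x n (k + 1) (discreteDeriv x n (k + 1) f) t =
      discreteDeriv x n k f t - discreteDeriv x n k f (x i) := by
  unfold weightMap
  simp only [hi]
  rw [if_pos hk, aux_deriv n _ x f t i hi, aux_deriv n _ x f t i hi,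
    aux_deriv n _ x f (x i) (i - 1) (aux_idx_pt n x hx i (by omega) hin),
    min_eq_left hk, min_eq_left (by omega), min_eq_left (by omega), divDiffVec]
  have e1 : i + 1 - (k + 1) + 1 = i + 1 - k := by omega
  have e2 : i - 1 + 1 - k = i + 1 - (k + 1) := by omega
  have e3 : i + 1 - (k + 1) + k + 1 = i + 1 := by omega
  rw [e1, e2, e3]
  rw [aux_dV_congr (fun m => if m ≤ i - 1 then x m else x i) (fun m => if m ≤ i then x m else t)
    (fun m => f (if m ≤ i - 1 then x m else x i)) (fun m => f (if m ≤ i then x m else t)) k]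
  · rw [if_neg (by omega), if_pos (by omega)]
    have : x (i + 1 - (k + 1)) < t := by
      rcases Nat.lt_or_ge (i + 1 - (k + 1)) i with h | h
      · exact (hx i _ (by omega) h hin).trans hit
      · rw [show i + 1 - (k + 1) = i by omega]; exact hit
    have h0 : t - x (i + 1 - (k + 1)) ≠ 0 := (sub_pos.2 this).ne'
    have h1 : ((k + 1 : ℕ) : ℝ) ≠ 0 := by positivity
    rw [Nat.factorial_succ]
    rw [show i + 1 - (k + 1) = i - k by omega] at *
    push_cast at h1 ⊢
    field_simp
  all_goals
    intro m h1 h2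
    by_cases h : m ≤ i - 1
    · simp [h, show m ≤ i by omega]
    · have : m = i := by omega
      subst this
      simp

lemma aux_cumSum (n k : ℕ) (x : ℕ → ℝ) (hx : ∀ m' m, 1 ≤ m → m < m' → m' ≤ n → x m < x m')
    (f : ℝ → ℝ) :
    cumSum x (k + 1) n (weightMap x n (k + 1) (discreteDeriv x n (k + 1) f)) =
      discreteDeriv x n k f := by
  funext t
  obtain ⟨i, hin, hi⟩ := aux_idx_ex n x hx t
  have hidx := aux_idx_eq n x t i hin hi
  unfold cumSum
  have hsum : ∀ (g : ℝ → ℝ), (∑ j ∈ Finset.Icc (k + 1) n, if x j < t then g (x j) else 0) =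
      ∑ j ∈ Finset.Icc (k + 1) i, g (x j) := by
    intro g
    rw [← Finset.sum_filter]
    apply Finset.sum_congr _ (fun _ _ => rfl)
    ext l
    simp only [Finset.mem_filter, Finset.mem_Icc]
    constructor
    · rintro ⟨⟨a, b⟩, c⟩; exact ⟨a, (hi l (by omega) b).1 c⟩
    · rintro ⟨a, b⟩; exact ⟨⟨a, by omega⟩, (hi l (by omega) (by omega)).2 b⟩
  rw [hsum]
  have htel : ∀ p, k + 1 ≤ p → p ≤ n → ∑ j ∈ Finset.Icc (k + 1) p,
      weightMap x n (k + 1) (discreteDeriv x n (k + 1) f) (x j) = discreteDeriv x n k f (x p) := by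
    intro p hp
    induction p, hp using Nat.le_induction with
    | base =>
      intro h
      rw [Finset.Icc_self, Finset.sum_singleton]
      exact aux_weight_lo n k x f _ k (aux_idx_pt n x hx (k + 1) (by omega) h) le_rfl
    | succ p hp ih =>
      intro h
      rw [Finset.sum_Icc_succ_top (by omega), ih (by omega),
        aux_weight_hi n k x hx f (x (p + 1)) p (by omega)
          (aux_idx_pt n x hx (p + 1) (by omega) h) (hx _ _ (by omega) (by omega) h) hp]
      ring
  rcases Nat.lt_or_ge k i with h | h
  · rw [htel i h hin, aux_weight_hi n k x hx f t i hin hidx ((hi i (by omega) hin).2 le_rfl) h]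
    ring
  · rw [Finset.Icc_eq_empty (by omega), Finset.sum_empty, aux_weight_lo n k x f t i hidx h, zero_add]

lemma aux_inverse (n : ℕ) (x : ℕ → ℝ) (hx : ∀ m' m, 1 ≤ m → m < m' → m' ≤ n → x m < x m')
    (f : ℝ → ℝ) : ∀ k, discreteInteg x n k (discreteDeriv x n k f) = f := by
  intro k
  induction k with
  | zero =>
    funext t
    rw [discreteInteg, aux_deriv n 0 x f t _ rfl]
    simp [divDiffVec]
  | succ k ih =>
    rw [discreteInteg, aux_cumSum n k x hx f, ih]

lemma aux_main (n k : ℕ) (x : ℕ → ℝ) (hx : ∀ m' m, 1 ≤ m → m < m' → m' ≤ n → x m < x m')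
    (j : ℕ) (h1 : k + 2 ≤ j) (h2 : j ≤ n) :
    discreteDeriv x n k (fallFact x k j) = fun t => if x (j - 1) < t then 1 else 0 := by
  funext t
  obtain ⟨i, hin, hi⟩ := aux_idx_ex n x hx t
  have hidx := aux_idx_eq n x t i hin hi
  rw [aux_deriv n k x _ t i hidx]
  have hle : ∀ m, 1 ≤ m → m ≤ j - 1 → x m ≤ x (j - 1) := by
    intro m a b
    rcases b.lt_or_eq with b | b
    · exact (hx _ _ a b (by omega)).le
    · rw [b]
  have hj := hi (j - 1) (by omega) (by omega)
  by_cases ht : x (j - 1) < t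
  · rw [if_pos ht]
    have hji := hj.1 ht
    rw [min_eq_left (by omega)]
    rw [aux_dV_congr _ (fun m => if m ≤ i then x m else t) _
      (fun m => (1 / (Nat.factorial k : ℝ)) * ∏ l ∈ Finset.Icc (j - k) (j - 1),
        ((fun m => if m ≤ i then x m else t) m - x l)) k _ (fun _ _ _ => rfl)]
    · rw [aux_dV_smul, aux_dV_prod _ x]
      · have : k = (Finset.Icc (j - k) (j - 1)).card := by simp; omega
        rw [if_pos this]
        have : (Nat.factorial k : ℝ) ≠ 0 := by positivity
        field_simp
      · intro m m' a b c
        rw [if_pos (by omega : m ≤ i)]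
        split_ifs with h
        · exact hx _ _ (by omega) b (by omega)
        · exact (hi m (by omega) (by omega)).2 (by omega)
      · simp; omega
    · intro m a b
      unfold fallFact
      rw [if_neg (by omega)]
      simp only
      by_cases hm : m ≤ j - 1
      · rw [if_pos (by omega : m ≤ i), if_neg (not_lt.2 (hle m (by omega) hm))]
        rw [Finset.prod_eq_zero (i := m) (Finset.mem_Icc.2 ⟨by omega, hm⟩) (sub_self _)]
        simp
      · rw [if_pos (c := x (j - 1) < _), mul_one]
        split_ifs with h
        · exact hx _ _ (by omega) (by omega) (by omega)
        · exact ht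
  · rw [if_neg ht]
    have hij : i < j - 1 := by
      by_contra hc
      exact ht (hj.2 (by omega))
    rw [aux_dV_congr _ (fun m => if m ≤ i then x m else t) _
      (fun m => 0 * (1 : ℝ)) _ _ (fun _ _ _ => rfl)]
    · rw [aux_dV_smul]; simp
    · intro m a b
      unfold fallFact
      rw [if_neg (by omega)]
      rw [if_neg (c := x (j - 1) < _)]
      · simp
      · split_ifs with h
        · exact not_lt.2 (hle m (by omega) (by omega))
        · exact ht

/-- Theorem: the falling factorial basis functions arise as discrete
integrals of step functions. For `j = k+2,…,n` and all `x ∈ [a,b]`,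
`(1/k!)·∏_{ℓ=j−k}^{j−1}(x−x_ℓ)·1{x > x_{j−1}} = (S^k_n 1_{x_{j−1}})(x)`; equivalently,
`(Δ^k_n h^k_j)(x) = 1{x > x_{j−1}}`. -/
theorem fallFact_eq_discreteInteg_step
    (n k : ℕ) (a b : ℝ) (x : ℕ → ℝ)
    (hn : k + 2 ≤ n)
    (hmono : ∀ i, 1 ≤ i → i < n → x i < x (i + 1))
    (ha : a ≤ x 1) (hb : x n ≤ b) (hab : x (n + 1) = b) :
    ∀ j ∈ Finset.Icc (k + 2) n, ∀ t ∈ Set.Icc a b,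
      ((1 / (Nat.factorial k : ℝ)) * (∏ ℓ ∈ Finset.Icc (j - k) (j - 1), (t - x ℓ)) *
          (if x (j - 1) < t then 1 else 0)
        = discreteInteg x n k (fun s => if x (j - 1) < s then 1 else 0) t) ∧
      discreteDeriv x n k (fallFact x k j) t = (if x (j - 1) < t then 1 else 0) := by
  have hx := aux_mono n x hmono
  intro j hj t _
  obtain ⟨h1, h2⟩ := Finset.mem_Icc.1 hj
  have hd := aux_main n k x hx j h1 h2
  refine ⟨?_, by rw [hd]⟩
  rw [← hd, aux_inverse n x hx (fallFact x k j) k]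
  unfold fallFact
  rw [if_neg (show ¬ j ≤ k + 1 by omega)]
end

section
/- Lateral recursion for the falling factorial basis: let k ≥ 1 and n ≥ k+2. For every integer d ≥ 0, every j with k+2 ≤ j ≤ n, and every x ∈ (x_i, x_{i+1}] with j−1 ≤ i ≤ n, one has (Δ^d_n h^k_j)(x) = Σ_{ℓ=j}^i (Δ^d_n h^{k−1}_ℓ)(x) · (x_ℓ − x_{ℓ−k})/k + (Δ^d_n h^{k−1}_{i+1})(x) · (x − x_{i−k+1})/k, where Δ^0_n is the identity, h^{k−1}_ℓ are the (k−1)-st degree falling factorial basis functions, and by convention h^{k−1}_{n+1}(x) = (1/(k−1)!)·∏_{ℓ=n−k+2}^{n}(x − x_ℓ)·1{x > x_n}. -/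
open Finset

theorem divDiff_linear_aux (N : ℕ) : ∀ L : List ℝ, L.length ≤ N →
    (∃ φ : (ℝ → ℝ) →ₗ[ℝ] ℝ, ∀ f, φ f = divDiff f L) ∧
    (∀ f g : ℝ → ℝ, (∀ s ∈ L, f s = g s) → divDiff f L = divDiff g L) := by
  induction N with
  | zero =>
    intro L hL
    have : L = [] := by simpa using hL
    subst this
    exact ⟨⟨0, fun f => by simp [divDiff]⟩, fun f g _ => by simp [divDiff]⟩
  | succ N ih =>
    intro L hL
    match L, hL with
    | [], _ => exact ⟨⟨0, fun f => by simp [divDiff]⟩, fun f g _ => by simp [divDiff]⟩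
    | [z], _ =>
      refine ⟨⟨LinearMap.proj z, fun f => by simp [divDiff]⟩, fun f g h => ?_⟩
      simpa [divDiff] using h
    | z :: y :: l, hL =>
      have hL' : l.length + 1 ≤ N := by simpa using hL
      obtain ⟨⟨φ1, h1⟩, c1⟩ := ih (y :: l) (by simpa using hL')
      obtain ⟨⟨φ2, h2⟩, c2⟩ := ih (z :: (y :: l).dropLast) (by simpa using hL')
      refine ⟨⟨((y :: l).getLast (List.cons_ne_nil y l) - z)⁻¹ • (φ1 - φ2), fun f => ?_⟩,
        fun f g h => ?_⟩
      · rw [divDiff]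
        simp only [LinearMap.smul_apply, LinearMap.sub_apply, h1, h2, smul_eq_mul]
        rw [div_eq_inv_mul]
      · rw [divDiff, divDiff, c1 f g, c2 f g]
        · intro s hs
          apply h
          rcases List.mem_cons.1 hs with rfl | hs
          · simp
          · exact List.mem_cons_of_mem _ (List.mem_of_mem_dropLast hs)
        · intro s hs
          exact h s (List.mem_cons_of_mem _ hs)

theorem divDiff_linear (L : List ℝ) : ∃ φ : (ℝ → ℝ) →ₗ[ℝ] ℝ, ∀ f, φ f = divDiff f L :=
  (divDiff_linear_aux _ L le_rfl).1

theorem divDiff_congr (L : List ℝ) (f g : ℝ → ℝ) (h : ∀ s ∈ L, f s = g s) :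
    divDiff f L = divDiff g L :=
  (divDiff_linear_aux _ L le_rfl).2 f g h

theorem discreteDeriv_linear (x : ℕ → ℝ) (n d : ℕ) (t : ℝ) :
    ∃ φ : (ℝ → ℝ) →ₗ[ℝ] ℝ, ∀ f, φ f = discreteDeriv x n d f t := by
  by_cases h : d ≤ discrIdx x n t
  · obtain ⟨φ, hφ⟩ := divDiff_linear (ctrs x (discrIdx x n t + 1 - d) (discrIdx x n t) ++ [t])
    exact ⟨(Nat.factorial d : ℝ) • φ, fun f => by simp [discreteDeriv, h, hφ]⟩
  · obtain ⟨φ, hφ⟩ := divDiff_linear (ctrs x 1 (discrIdx x n t) ++ [t])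
    exact ⟨(Nat.factorial (discrIdx x n t) : ℝ) • φ, fun f => by simp [discreteDeriv, h, hφ]⟩

theorem discreteDeriv_congr (x : ℕ → ℝ) (n d : ℕ) (t : ℝ) (f g : ℝ → ℝ) (ht : f t = g t)
    (h : ∀ m, 1 ≤ m → m ≤ discrIdx x n t → f (x m) = g (x m)) :
    discreteDeriv x n d f t = discreteDeriv x n d g t := by
  unfold discreteDeriv
  dsimp only
  split_ifs with hd
  · congr 1
    apply divDiff_congr
    intro s hs
    simp only [ctrs, List.mem_append, List.mem_map, List.mem_range, List.mem_singleton] at hs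
    rcases hs with ⟨m, hm, rfl⟩ | rfl
    · apply h <;> omega
    · exact ht
  · congr 1
    apply divDiff_congr
    intro s hs
    simp only [ctrs, List.mem_append, List.mem_map, List.mem_range, List.mem_singleton] at hs
    rcases hs with ⟨m, hm, rfl⟩ | rfl
    · apply h <;> omega
    · exact ht

theorem fallFact_factor (x : ℕ → ℝ) (k i : ℕ) (hi : k + 2 ≤ i) (s : ℝ) :
    fallFact x (k + 1) (i + 1) s =
      fallFact x k (i + 1) s * ((s - x (i - k)) / ((k + 1 : ℕ) : ℝ)) := by
  unfold fallFact
  rw [if_neg (by omega : ¬ i + 1 ≤ k + 1 + 1), if_neg (by omega : ¬ i + 1 ≤ k + 1)]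
  have e1 : i + 1 - (k + 1) = i - k := by omega
  have e2 : i + 1 - k = i - k + 1 := by omega
  have e3 : i + 1 - 1 = i := by omega
  rw [e1, e2, e3, ← Finset.insert_Icc_add_one_left_eq_Icc (by omega : i - k ≤ i),
    Finset.prod_insert (by simp), Nat.factorial_succ]
  have : (Nat.factorial k : ℝ) ≠ 0 := by positivity
  push_cast
  field_simp

theorem fallFact_step (x : ℕ → ℝ) (k l : ℕ) (hl : k + 3 ≤ l) (s : ℝ) (hx : x (l - 1) < x l)
    (hs : s ≤ x (l - 1) ∨ x l ≤ s) :
    fallFact x (k + 1) l s =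
      fallFact x k l s * ((x l - x (l - (k + 1))) / ((k + 1 : ℕ) : ℝ))
        + fallFact x (k + 1) (l + 1) s := by
  obtain ⟨p, rfl⟩ : ∃ p, l = p + 1 := ⟨l - 1, by omega⟩
  rw [fallFact_factor x k p (by omega)]
  have e1 : p + 1 - (k + 1) = p - k := by omega
  have e2 : p + 1 - k = p - k + 1 := by omega
  rw [e1]
  simp only [Nat.add_sub_cancel] at hs hx
  have key : fallFact x (k + 1) (p + 1 + 1) s
      = fallFact x k (p + 1) s * ((s - x (p + 1)) / ((k + 1 : ℕ) : ℝ)) := by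
    unfold fallFact
    rw [if_neg (by omega : ¬ p + 1 + 1 ≤ k + 1 + 1), if_neg (by omega : ¬ p + 1 ≤ k + 1)]
    have e3 : p + 1 + 1 - (k + 1) = p - k + 1 := by omega
    simp only [Nat.add_sub_cancel]
    rw [e3, e2]
    rcases hs with hs | hs
    · rw [if_neg (by linarith : ¬ x (p + 1) < s), if_neg (by linarith : ¬ x p < s)]; simp
    · rw [if_pos (by linarith : x p < s), ← Finset.insert_Icc_right_eq_Icc_add_one (by omega : p - k + 1 ≤ p + 1),
        Finset.prod_insert (by simp), Nat.factorial_succ]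
      have : (Nat.factorial k : ℝ) ≠ 0 := by positivity
      rcases hs.eq_or_lt with hs | hs
      · subst hs; simp
      · rw [if_pos hs]
        push_cast
        field_simp
  rw [key]; ring

theorem fallFact_tele (x : ℕ → ℝ) (k j : ℕ) (hj : k + 3 ≤ j) (s : ℝ) (r : ℕ)
    (hx : ∀ l, j ≤ l → l < j + r → x (l - 1) < x l)
    (hs : ∀ l, j ≤ l → l < j + r → s ≤ x (l - 1) ∨ x l ≤ s) :
    fallFact x (k + 1) j s =
      (∑ l ∈ Finset.Ico j (j + r),
        fallFact x k l s * ((x l - x (l - (k + 1))) / ((k + 1 : ℕ) : ℝ)))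
        + fallFact x (k + 1) (j + r) s := by
  induction r with
  | zero => simp
  | succ r ih =>
    rw [ih (fun l h1 h2 => hx l h1 (by omega)) (fun l h1 h2 => hs l h1 (by omega)),
      ← add_assoc, Finset.sum_Ico_succ_top (by omega),
      fallFact_step x k (j + r) (by omega) s (hx _ (by omega) (by omega)) (hs _ (by omega) (by omega))]
    ring

/-- Lemma: lateral recursion for the falling factorial basis.
For all `d ≥ 0`, all `j` with `k+2 ≤ j ≤ n`, and all `x ∈ (x_i, x_{i+1}]` with
`j−1 ≤ i ≤ n`:
`(Δ^d_n h^k_j)(x) = Σ_{ℓ=j}^i (Δ^d_n h^{k−1}_ℓ)(x)·(x_ℓ−x_{ℓ−k})/k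
  + (Δ^d_n h^{k−1}_{i+1})(x)·(x−x_{i−k+1})/k`.
Here `h^{k−1}_{n+1}(x) = (1/(k−1)!)·∏_{ℓ=n−k+2}^n (x−x_ℓ)·1{x > x_n}`, which is exactly
`fallFact x (k−1) (n+1)`. -/
theorem fallFact_lateral_recursion
    (n k : ℕ) (a b : ℝ) (x : ℕ → ℝ)
    (hk : 1 ≤ k) (hn : k + 2 ≤ n)
    (hmono : ∀ i, 1 ≤ i → i < n → x i < x (i + 1))
    (ha : a ≤ x 1) (hb : x n ≤ b) (hab : x (n + 1) = b) :
    ∀ d : ℕ, ∀ j ∈ Finset.Icc (k + 2) n, ∀ i ∈ Finset.Icc (j - 1) n,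
      ∀ t : ℝ, x i < t → t ≤ x (i + 1) →
        discreteDeriv x n d (fallFact x k j) t =
          (∑ ℓ ∈ Finset.Icc j i,
              discreteDeriv x n d (fallFact x (k - 1) ℓ) t * ((x ℓ - x (ℓ - k)) / k))
          + discreteDeriv x n d (fallFact x (k - 1) (i + 1)) t *
              ((t - x (i + 1 - k)) / k) := by
  intro d j hj i hi t hit hti
  obtain ⟨k, rfl⟩ : ∃ q, k = q + 1 := ⟨k - 1, by omega⟩
  rw [Finset.mem_Icc] at hj hi
  have hlt : ∀ p q, 1 ≤ p → p < q → q ≤ n → x p < x q := by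
    intro p q hp hpq
    induction q, hpq using Nat.le_induction with
    | base => intro hq; exact hmono p hp (by omega)
    | succ q hq ih => intro h; exact (ih (by omega)).trans (hmono q (by omega) (by omega))
  have hle : ∀ p q, 1 ≤ p → p ≤ q → q ≤ n → x p ≤ x q := by
    intro p q hp hpq hq
    rcases hpq.eq_or_lt with rfl | h
    · exact le_rfl
    · exact (hlt p q hp h hq).le
  have hidx : discrIdx x n t = i := by
    unfold discrIdx
    have : (Finset.Icc 1 n).filter (fun m => x m < t) = Finset.Icc 1 i := by
      ext m
      simp only [Finset.mem_filter, Finset.mem_Icc]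
      constructor
      · rintro ⟨⟨h1, h2⟩, h3⟩
        refine ⟨h1, ?_⟩
        by_contra h
        have := hle (i + 1) m (by omega) (by omega) h2
        linarith
      · rintro ⟨h1, h2⟩
        have := hle m i h1 h2 hi.2
        exact ⟨⟨h1, by omega⟩, by linarith⟩
    rw [this]; simp
  have hIcc : Finset.Icc j i = Finset.Ico j (i + 1) := by ext m; simp
  obtain ⟨r, hr⟩ : ∃ r, i + 1 = j + r := ⟨i + 1 - j, by omega⟩
  have hik : i + 1 - (k + 1) = i - k := by omega
  simp only [Nat.add_sub_cancel]
  rw [hIcc, hik]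
  obtain ⟨φ, hφ⟩ := discreteDeriv_linear x n d t
  have hmain : discreteDeriv x n d (fallFact x (k + 1) j) t = discreteDeriv x n d
      ((∑ l ∈ Finset.Ico j (i + 1), ((x l - x (l - (k + 1))) / ((k + 1 : ℕ) : ℝ)) • fallFact x k l)
        + ((t - x (i - k)) / ((k + 1 : ℕ) : ℝ)) • fallFact x k (i + 1)) t := by
    apply discreteDeriv_congr
    · simp only [Pi.add_apply, Finset.sum_apply, Pi.smul_apply, smul_eq_mul]
      rw [fallFact_tele x k j (by omega) t r, ← hr, fallFact_factor x k i (by omega)]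
      · congr 1
        · exact Finset.sum_congr rfl fun l _ => mul_comm _ _
        · ring
      · intro l h1 h2; exact hlt _ _ (by omega) (by omega) (by omega)
      · intro l h1 h2; right
        have := hle l i (by omega) (by omega) hi.2
        linarith
    · rw [hidx]
      intro m hm1 hm2
      simp only [Pi.add_apply, Finset.sum_apply, Pi.smul_apply, smul_eq_mul]
      have hz : fallFact x k (i + 1) (x m) = 0 := by
        have := hle m i hm1 hm2 hi.2
        unfold fallFact
        rw [if_neg (by omega), Nat.add_sub_cancel, if_neg (by linarith)]; simp
      rw [fallFact_tele x k j (by omega) (x m) r, ← hr, fallFact_factor x k i (by omega), hz]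
      · congr 1
        · exact Finset.sum_congr rfl fun l _ => mul_comm _ _
        · ring
      · intro l h1 h2; exact hlt _ _ (by omega) (by omega) (by omega)
      · intro l h1 h2
        rcases Nat.lt_or_ge m l with h | h
        · left; exact hle _ _ (by omega) (by omega) (by omega)
        · right; exact hle _ _ (by omega) (by omega) (by omega)
  rw [hmain, ← hφ]
  rw [map_add, map_sum]
  simp only [map_smul, smul_eq_mul]
  simp only [hφ]
  congr 1
  · exact Finset.sum_congr rfl fun l _ => mul_comm _ _
  · ring
end

section
/- Let k ≥ 0 and n ≥ k+2. A function f on [a,b] belongs to H^k_n (the span of the k-th degree falling factorial basis) if and only if f is a k-th degree discrete spline on [a,b] with knots x_{k+1}, …, x_{n−1}; that is, H^k_n = DS^k_n(x_{(k+1):(n−1)}, [a,b]). Moreover, h^k_1, …, h^k_n are linearly independent, so they form a basis of this n-dimensional space. -/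
open Finset

theorem divDiff_congr_aux (f g : ℝ → ℝ) : ∀ (N : ℕ) (l : List ℝ), l.length ≤ N →
    (∀ z ∈ l, f z = g z) → divDiff f l = divDiff g l := by
  intro N
  induction N with
  | zero =>
    intro l hl h
    have : l = [] := by simpa using hl
    subst this
    simp [divDiff]
  | succ N ih =>
    intro l hl h
    match l, hl, h with
    | [], _, _ => simp [divDiff]
    | [z], _, h => simpa [divDiff] using h
    | z :: y :: l, hl, h =>
      have h1 : divDiff f (y :: l) = divDiff g (y :: l) := by
        apply ih
        · simp at hl ⊢; omega
        · intro w hw; exact h w (List.mem_cons_of_mem _ hw)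
      have h2 : divDiff f (z :: (y :: l).dropLast) = divDiff g (z :: (y :: l).dropLast) := by
        apply ih
        · simp at hl ⊢; omega
        · intro w hw
          rcases List.mem_cons.1 hw with rfl | hw
          · exact h _ (by simp)
          · exact h w (List.mem_cons_of_mem _ (List.mem_of_mem_dropLast hw))
      rw [divDiff, divDiff, h1, h2]

theorem divDiff_inj_aux (f g : ℝ → ℝ) : ∀ (N : ℕ) (z : ℝ) (l : List ℝ), l.length ≤ N →
    (∀ w ∈ l, w ≠ z) → (∀ w ∈ l, f w = g w) → divDiff f (z :: l) = divDiff g (z :: l) →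
    f z = g z := by
  intro N
  induction N with
  | zero =>
    intro z l hl hz h he
    have : l = [] := by simpa using hl
    subst this
    simpa [divDiff] using he
  | succ N ih =>
    intro z l hl hz h he
    match l, hl, hz, h, he with
    | [], _, _, _, he => simpa [divDiff] using he
    | y :: l, hl, hz, h, he =>
      have h1 : divDiff f (y :: l) = divDiff g (y :: l) :=
        divDiff_congr_aux f g _ _ le_rfl h
      rw [divDiff, divDiff, h1] at he
      have hne : (y :: l).getLast (List.cons_ne_nil y l) - z ≠ 0 :=
        sub_ne_zero.2 (hz _ (List.getLast_mem _))
      rw [div_left_inj' hne] at he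
      apply ih z (y :: l).dropLast
      · simp at hl ⊢; omega
      · intro w hw; exact hz w (List.mem_of_mem_dropLast hw)
      · intro w hw; exact h w (List.mem_of_mem_dropLast hw)
      · linarith

theorem x_strict {n : ℕ} {x : ℕ → ℝ} (hmono : ∀ i, 1 ≤ i → i < n → x i < x (i + 1)) :
    ∀ i j, 1 ≤ i → i < j → j ≤ n → x i < x j := by
  intro i j hi hij
  induction j, hij using Nat.le_induction with
  | base => intro h; exact hmono i hi h
  | succ j hj ih =>
    intro h
    have hj' : i < j := hj
    exact (ih (by omega)).trans (hmono j (by omega) (by omega))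

theorem x_mono {n : ℕ} {x : ℕ → ℝ} (hmono : ∀ i, 1 ≤ i → i < n → x i < x (i + 1))
    (i j : ℕ) (hi : 1 ≤ i) (hij : i ≤ j) (hj : j ≤ n) : x i ≤ x j := by
  rcases hij.eq_or_lt with rfl | h
  · exact le_rfl
  · exact (x_strict hmono i j hi h hj).le

theorem discrIdx_x {n : ℕ} {x : ℕ → ℝ} (hmono : ∀ i, 1 ≤ i → i < n → x i < x (i + 1))
    (m : ℕ) (hm : 1 ≤ m) (hmn : m ≤ n) : discrIdx x n (x m) = m - 1 := by
  unfold discrIdx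
  have : ((Finset.Icc 1 n).filter fun i => x i < x m) = Finset.Icc 1 (m - 1) := by
    ext i
    simp only [Finset.mem_filter, Finset.mem_Icc]
    constructor
    · rintro ⟨⟨h1, h2⟩, h3⟩
      refine ⟨h1, ?_⟩
      by_contra h
      exact absurd h3 (not_lt.2 (x_mono hmono m i hm (by omega) h2))
    · rintro ⟨h1, h2⟩
      exact ⟨⟨h1, by omega⟩, x_strict hmono i m h1 (by omega) hmn⟩
  rw [this]
  simp

/-- the list of centers as a set of indices -/
theorem mem_ctrs_app {x : ℕ → ℝ} {m l : ℕ} (hl : l < m) {w : ℝ} :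
    w ∈ ctrs x (m - l) (m - 1) ++ [x m] ↔ ∃ r, r ≤ l ∧ w = x (m - r) := by
  simp only [ctrs, List.mem_append, List.mem_map, List.mem_range, List.mem_singleton]
  constructor
  · rintro (⟨s, hs, rfl⟩ | rfl)
    · exact ⟨l - s, by omega, by congr 1; omega⟩
    · exact ⟨0, by omega, by simp⟩
  · rintro ⟨r, hr, rfl⟩
    rcases Nat.eq_zero_or_pos r with rfl | h
    · right; simp
    · left; exact ⟨l - r, by omega, by congr 1; omega⟩

theorem ctrs_app_succ {x : ℕ → ℝ} {m l : ℕ} (hl : l + 1 < m) :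
    ctrs x (m - (l + 1)) (m - 1) ++ [x m] =
      x (m - (l + 1)) :: (ctrs x (m - l) (m - 1) ++ [x m]) := by
  have e1 : m - 1 + 1 - (m - (l + 1)) = l + 1 := by omega
  have e2 : m - 1 + 1 - (m - l) = l := by omega
  simp only [ctrs, e1, e2, List.range_succ_eq_map, List.map_cons, List.map_map, List.cons_append,
    Nat.add_zero]
  congr 3
  funext s
  simp only [Function.comp]
  congr 1
  omega

theorem discreteDeriv_x {n : ℕ} {x : ℕ → ℝ} (hmono : ∀ i, 1 ≤ i → i < n → x i < x (i + 1))
    (m l : ℕ) (hl : l < m) (hmn : m ≤ n) (f : ℝ → ℝ) :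
    discreteDeriv x n l f (x m) =
      (Nat.factorial l : ℝ) * divDiff f (ctrs x (m - l) (m - 1) ++ [x m]) := by
  have h := discrIdx_x hmono m (by omega) hmn
  unfold discreteDeriv
  simp only [h]
  rw [if_pos (by omega)]
  have : m - 1 + 1 - l = m - l := by omega
  rw [this]

theorem match_iff {n : ℕ} {x : ℕ → ℝ} (hmono : ∀ i, 1 ≤ i → i < n → x i < x (i + 1))
    (k m : ℕ) (hk : k < m) (hmn : m ≤ n) (f g : ℝ → ℝ) :
    (∀ l < k, discreteDeriv x n l f (x m) = discreteDeriv x n l g (x m)) ↔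
      ∀ r < k, f (x (m - r)) = g (x (m - r)) := by
  constructor
  · intro h r
    induction r using Nat.strong_induction_on with
    | _ r ih =>
      intro hr
      have h1 := h r hr
      rw [discreteDeriv_x hmono m r (by omega) hmn, discreteDeriv_x hmono m r (by omega) hmn] at h1
      have h2 := mul_left_cancel₀ (by positivity) h1
      rcases r with _ | r
      · simpa [ctrs, divDiff, show m - 1 + 1 - m = 0 by omega] using h2
      · rw [ctrs_app_succ (by omega)] at h2
        refine divDiff_inj_aux f g _ _ _ le_rfl ?_ ?_ h2
        · intro w hw
          obtain ⟨s, hs, rfl⟩ := (mem_ctrs_app (by omega)).1 hw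
          exact (x_strict hmono _ _ (by omega) (by omega) (by omega)).ne'
        · intro w hw
          obtain ⟨s, hs, rfl⟩ := (mem_ctrs_app (by omega)).1 hw
          exact ih s (by omega) (by omega)
  · intro h l hl
    rw [discreteDeriv_x hmono m l (by omega) hmn, discreteDeriv_x hmono m l (by omega) hmn]
    congr 1
    refine divDiff_congr_aux f g _ _ le_rfl ?_
    intro w hw
    obtain ⟨s, hs, rfl⟩ := (mem_ctrs_app (by omega)).1 hw
    exact h s (by omega)

/-- polynomial piece of the falling factorial function -/
noncomputable def ffPoly (x : ℕ → ℝ) (k j : ℕ) : Polynomial ℝ :=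
  if j ≤ k + 1 then
    Polynomial.C (1 / (Nat.factorial (j - 1) : ℝ)) *
      ∏ ℓ ∈ Finset.Icc 1 (j - 1), (Polynomial.X - Polynomial.C (x ℓ))
  else
    Polynomial.C (1 / (Nat.factorial k : ℝ)) *
      ∏ ℓ ∈ Finset.Icc (j - k) (j - 1), (Polynomial.X - Polynomial.C (x ℓ))

theorem fallFact_low (x : ℕ → ℝ) (k j : ℕ) (t : ℝ) (hj : j ≤ k + 1) :
    fallFact x k j t = (ffPoly x k j).eval t := by
  simp [fallFact, ffPoly, hj, Polynomial.eval_prod]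

theorem fallFact_pos (x : ℕ → ℝ) (k j : ℕ) (t : ℝ) (hj : k + 2 ≤ j) (ht : x (j - 1) < t) :
    fallFact x k j t = (ffPoly x k j).eval t := by
  simp [fallFact, ffPoly, show ¬ j ≤ k + 1 by omega, Polynomial.eval_prod, ht]

theorem fallFact_neg (x : ℕ → ℝ) (k j : ℕ) (t : ℝ) (hj : k + 2 ≤ j) (ht : t ≤ x (j - 1)) :
    fallFact x k j t = 0 := by
  simp [fallFact, show ¬ j ≤ k + 1 by omega, ht]

theorem ffPoly_natDegree (x : ℕ → ℝ) (k j : ℕ) : (ffPoly x k j).natDegree ≤ k := by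
  unfold ffPoly
  split_ifs with h
  · refine (Polynomial.natDegree_C_mul_le _ _).trans ?_
    rw [Polynomial.natDegree_finsetProd_X_sub_C_eq_card]
    simp; omega
  · refine (Polynomial.natDegree_C_mul_le _ _).trans ?_
    rw [Polynomial.natDegree_finsetProd_X_sub_C_eq_card]
    simp; omega

/-- partial sums -/
noncomputable def ffSum (x : ℕ → ℝ) (k : ℕ) (c : ℕ → ℝ) (m : ℕ) : Polynomial ℝ :=
  ∑ j ∈ Finset.Icc 1 m, Polynomial.C (c j) * ffPoly x k j

theorem ffSum_succ (x : ℕ → ℝ) (k : ℕ) (c : ℕ → ℝ) (m : ℕ) :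
    ffSum x k c (m + 1) = ffSum x k c m + Polynomial.C (c (m + 1)) * ffPoly x k (m + 1) := by
  unfold ffSum
  rw [Finset.sum_Icc_succ_top (by omega)]

theorem ffSum_natDegree (x : ℕ → ℝ) (k : ℕ) (c : ℕ → ℝ) (m : ℕ) :
    (ffSum x k c m).natDegree ≤ k := by
  unfold ffSum
  refine Polynomial.natDegree_sum_le_of_forall_le _ _ ?_
  intro j _
  exact (Polynomial.natDegree_C_mul_le _ _).trans (ffPoly_natDegree x k j)

theorem ff_piece (x : ℕ → ℝ) (k n m : ℕ) (c : ℕ → ℝ) (t : ℝ) (hm : k + 1 ≤ m) (hmn : m ≤ n)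
    (h1 : ∀ j, k + 2 ≤ j → j ≤ m → x (j - 1) < t)
    (h2 : ∀ j, m + 1 ≤ j → j ≤ n → t ≤ x (j - 1)) :
    ∑ j ∈ Finset.Icc 1 n, c j * fallFact x k j t = (ffSum x k c m).eval t := by
  unfold ffSum
  rw [Polynomial.eval_finsetSum]
  have hs : Finset.Icc 1 m ⊆ Finset.Icc 1 n := Finset.Icc_subset_Icc le_rfl hmn
  rw [← Finset.sum_subset hs]
  · refine Finset.sum_congr rfl ?_
    intro j hj
    rw [Finset.mem_Icc] at hj
    rw [Polynomial.eval_mul, Polynomial.eval_C]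
    congr 1
    by_cases h : j ≤ k + 1
    · exact fallFact_low x k j t h
    · exact fallFact_pos x k j t (by omega) (h1 j (by omega) hj.2)
  · intro j hj hj'
    rw [Finset.mem_Icc] at hj hj'
    rw [fallFact_neg x k j t (by omega) (h2 j (by omega) hj.2), mul_zero]

theorem deg_drop (k : ℕ) (q r : Polynomial ℝ) (hq : q.natDegree ≤ k) (hr : r.natDegree = k)
    (hm : r.Monic) : (q - Polynomial.C (q.coeff k) * r).degree < k := by
  rw [Polynomial.degree_lt_iff_coeff_zero]
  intro m hkm
  rcases hkm.eq_or_lt with rfl | h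
  · have : r.coeff k = 1 := by rw [← hr]; exact hm
    simp [this]
  · rw [Polynomial.coeff_sub, Polynomial.coeff_C_mul,
      Polynomial.coeff_eq_zero_of_natDegree_lt (by omega),
      Polynomial.coeff_eq_zero_of_natDegree_lt (p := r) (by omega)]
    simp

theorem newton_aux (x : ℕ → ℝ) (k : ℕ) : ∀ d ≤ k + 1, ∀ q : Polynomial ℝ, q.degree < d →
    ∃ c : ℕ → ℝ, q = ffSum x k c d := by
  intro d
  induction d with
  | zero =>
    intro _ q hq
    refine ⟨0, ?_⟩
    have : q = 0 := by
      rw [← Polynomial.degree_eq_bot]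
      exact Nat.WithBot.lt_zero_iff.1 (by simpa using hq)
    simp [ffSum, this]
  | succ d ih =>
    intro hd q hq
    have hq' : q.natDegree ≤ d := by
      rw [Polynomial.natDegree_le_iff_coeff_eq_zero]
      intro N hN
      exact (Polynomial.degree_lt_iff_coeff_zero q (d + 1)).1 hq N hN
    obtain ⟨c, hc⟩ := ih (by omega) _ (deg_drop d q
      (∏ ℓ ∈ Finset.Icc 1 d, (Polynomial.X - Polynomial.C (x ℓ))) hq'
      (by rw [Polynomial.natDegree_finsetProd_X_sub_C_eq_card]; simp)
      (Polynomial.monic_prod_X_sub_C _ _))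
    refine ⟨Function.update c (d + 1) (q.coeff d * (Nat.factorial d : ℝ)), ?_⟩
    rw [ffSum_succ]
    have h1 : ffSum x k (Function.update c (d + 1) (q.coeff d * (Nat.factorial d : ℝ))) d
        = ffSum x k c d := by
      unfold ffSum
      refine Finset.sum_congr rfl ?_
      intro j hj
      rw [Finset.mem_Icc] at hj
      rw [Function.update_of_ne (by omega)]
    rw [h1, ← hc, Function.update_self, ffPoly, if_pos hd, ← mul_assoc, ← Polynomial.C_mul]
    have : q.coeff d * (Nat.factorial d : ℝ) * (1 / (Nat.factorial (d + 1 - 1) : ℝ))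
        = q.coeff d := by
      simp only [Nat.add_sub_cancel]
      field_simp
    rw [this]
    simp

theorem jump_aux {n : ℕ} {x : ℕ → ℝ} (hmono : ∀ i, 1 ≤ i → i < n → x i < x (i + 1))
    (k m : ℕ) (hk : k < m) (hmn : m ≤ n) (q : Polynomial ℝ) (hq : q.natDegree ≤ k)
    (hv : ∀ r < k, q.eval (x (m - r)) = 0) :
    ∃ c : ℝ, q = Polynomial.C c * ffPoly x k (m + 1) := by
  refine ⟨q.coeff k * (Nat.factorial k : ℝ), ?_⟩
  rw [ffPoly, if_neg (by omega), ← mul_assoc, ← Polynomial.C_mul]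
  have : q.coeff k * (Nat.factorial k : ℝ) * (1 / (Nat.factorial k : ℝ)) = q.coeff k := by
    field_simp
  rw [this, ← sub_eq_zero]
  have hcard : (Finset.Icc (m + 1 - k) (m + 1 - 1)).card = k := by simp; omega
  refine Polynomial.eq_zero_of_degree_lt_of_eval_index_eq_zero
    (s := Finset.Icc (m + 1 - k) (m + 1 - 1)) (v := x) ?_ ?_ ?_
  · intro i hi j hj hij
    simp only [Finset.coe_Icc, Set.mem_Icc] at hi hj
    rcases lt_trichotomy i j with h | h | h
    · exact absurd hij (x_strict hmono i j (by omega) h (by omega)).ne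
    · exact h
    · exact absurd hij (x_strict hmono j i (by omega) h (by omega)).ne'
  · rw [hcard]
    exact deg_drop k q _ hq (by rw [Polynomial.natDegree_finsetProd_X_sub_C_eq_card, hcard])
      (Polynomial.monic_prod_X_sub_C _ _)
  · intro i hi
    have hi' := Finset.mem_Icc.1 hi
    have h0 := hv (m - i) (by omega)
    rw [show m - (m - i) = i by omega] at h0
    rw [Polynomial.eval_sub, h0, Polynomial.eval_mul, Polynomial.eval_prod,
      Finset.prod_eq_zero hi (by simp)]
    simp

theorem ffPoly_vanish {x : ℕ → ℝ} (k m r : ℕ) (hk : k < m) (hr : r < k) :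
    (ffPoly x k (m + 1)).eval (x (m - r)) = 0 := by
  rw [ffPoly, if_neg (by omega), Polynomial.eval_mul, Polynomial.eval_prod,
    Finset.prod_eq_zero (i := m - r) (by rw [Finset.mem_Icc]; omega) (by simp), mul_zero]

theorem ff_diag {n : ℕ} {x : ℕ → ℝ} (hmono : ∀ i, 1 ≤ i → i < n → x i < x (i + 1))
    (k j : ℕ) (hj : 1 ≤ j) (hjn : j ≤ n) : fallFact x k j (x j) ≠ 0 := by
  have hf : ∀ d : ℕ, (1 / (Nat.factorial d : ℝ)) ≠ 0 := fun d => by positivity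
  by_cases h : j ≤ k + 1
  · rw [fallFact, if_pos h]
    refine mul_ne_zero (hf _) (Finset.prod_ne_zero_iff.2 ?_)
    intro l hl
    rw [Finset.mem_Icc] at hl
    exact sub_ne_zero.2 (x_strict hmono l j hl.1 (by omega) hjn).ne'
  · rw [fallFact, if_neg h, if_pos (x_strict hmono _ _ (by omega) (by omega) hjn), mul_one]
    refine mul_ne_zero (hf _) (Finset.prod_ne_zero_iff.2 ?_)
    intro l hl
    rw [Finset.mem_Icc] at hl
    exact sub_ne_zero.2 (x_strict hmono l j (by omega) (by omega) hjn).ne'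

theorem ff_upper {n : ℕ} {x : ℕ → ℝ} (hmono : ∀ i, 1 ≤ i → i < n → x i < x (i + 1))
    (k i j : ℕ) (hi : 1 ≤ i) (hij : i < j) (hjn : j ≤ n) : fallFact x k j (x i) = 0 := by
  by_cases h : j ≤ k + 1
  · rw [fallFact, if_pos h,
      Finset.prod_eq_zero (i := i) (by rw [Finset.mem_Icc]; omega) (by simp), mul_zero]
  · exact fallFact_neg x k j _ (by omega) (x_mono hmono i (j - 1) hi (by omega) (by omega))

/-- Lemma: the span of the falling factorial basis is the space of
discrete splines. `H^k_n = DS^k_n(x_{(k+1):(n−1)}, [a,b])`: a function `f` on `[a,b]`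
lies in the span of `h^k_1,…,h^k_n` iff there are polynomials `p_0,…,p_r` (`r = n−k−1`)
of degree ≤ k with `f = p_0` on `[a, x_{k+1}]`, `f = p_i` on `(x_{k+i}, x_{k+i+1}]` for
`i = 1,…,r−1`, `f = p_r` on `(x_{n−1}, b]`, and `(Δ^ℓ_n p_{i−1})(x_{k+i}) = (Δ^ℓ_n p_i)(x_{k+i})`
for each `i = 1,…,r` and `ℓ = 0,…,k−1`.  Moreover `h^k_1,…,h^k_n` are linearly independent. -/
theorem ffSpan_eq_discreteSplines
    (n k : ℕ) (a b : ℝ) (x : ℕ → ℝ)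
    (hn : k + 2 ≤ n)
    (hmono : ∀ i, 1 ≤ i → i < n → x i < x (i + 1))
    (ha : a ≤ x 1) (hb : x n ≤ b) (hab : x (n + 1) = b) :
    (∀ f : ℝ → ℝ,
      inFFSpan x n k a b f ↔
        ∃ p : ℕ → Polynomial ℝ,
          (∀ i ∈ Finset.range (n - k), (p i).natDegree ≤ k) ∧
          (∀ t ∈ Set.Icc a (x (k + 1)), f t = (p 0).eval t) ∧
          (∀ i ∈ Finset.Icc 1 (n - k - 1),
            ∀ t ∈ Set.Ioc (x (k + i)) (if i = n - k - 1 then b else x (k + i + 1)),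
              f t = (p i).eval t) ∧
          (∀ i ∈ Finset.Icc 1 (n - k - 1), ∀ ℓ < k,
            discreteDeriv x n ℓ (fun s => (p (i - 1)).eval s) (x (k + i)) =
              discreteDeriv x n ℓ (fun s => (p i).eval s) (x (k + i)))) ∧
    (∀ c : ℕ → ℝ,
      (∀ t ∈ Set.Icc a b, (∑ j ∈ Finset.Icc 1 n, c j * fallFact x k j t) = 0) →
      ∀ j ∈ Finset.Icc 1 n, c j = 0) := by
  refine ⟨fun f => ⟨?_, ?_⟩, ?_⟩
  · rintro ⟨c, hc⟩
    refine ⟨fun i => ffSum x k c (k + 1 + i), fun i _ => ffSum_natDegree _ _ _ _, ?_, ?_, ?_⟩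
    · intro t ht
      have htb : t ≤ b := ht.2.trans ((x_mono hmono _ n (by omega) (by omega) le_rfl).trans hb)
      rw [hc t ⟨ht.1, htb⟩]
      refine ff_piece x k n (k + 1 + 0) c t (by omega) (by omega) ?_ ?_
      · intro j h1 h2; omega
      · intro j h1 h2
        exact ht.2.trans (x_mono hmono _ _ (by omega) (by omega) (by omega))
    · intro i hi t ht
      rw [Finset.mem_Icc] at hi
      have hat : a ≤ t :=
        ha.trans ((x_mono hmono 1 (k + i) le_rfl (by omega) (by omega)).trans ht.1.le)
      have htb : t ≤ b := by
        have := ht.2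
        split_ifs at this with h
        · exact this
        · exact this.trans ((x_mono hmono _ n (by omega) (by omega) le_rfl).trans hb)
      rw [hc t ⟨hat, htb⟩]
      refine ff_piece x k n (k + 1 + i) c t (by omega) (by omega) ?_ ?_
      · intro j h1 h2
        exact (x_mono hmono _ _ (by omega) (by omega) (by omega)).trans_lt ht.1
      · intro j h1 h2
        have := ht.2
        rw [if_neg (by omega)] at this
        exact this.trans (x_mono hmono _ _ (by omega) (by omega) (by omega))
    · intro i hi
      rw [Finset.mem_Icc] at hi
      refine (match_iff hmono k (k + i) (by omega) (by omega) _ _).2 ?_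
      intro r hr
      have e1 : k + 1 + (i - 1) = k + i := by omega
      have e2 : k + 1 + i = (k + i) + 1 := by omega
      simp only [e1, e2, ffSum_succ, Polynomial.eval_add, Polynomial.eval_mul]
      rw [ffPoly_vanish k (k + i) r (by omega) hr]
      simp
  · rintro ⟨p, hdeg, h0, hi, hmatch⟩
    have hj : ∀ i, ∃ c : ℝ, i ∈ Finset.Icc 1 (n - k - 1) →
        p i - p (i - 1) = Polynomial.C c * ffPoly x k (k + i + 1) := by
      intro i
      by_cases hmem : i ∈ Finset.Icc 1 (n - k - 1)
      · have hmem' := Finset.mem_Icc.1 hmem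
        have hm := (match_iff hmono k (k + i) (by omega) (by omega) _ _).1 (hmatch i hmem)
        obtain ⟨c, hc⟩ := jump_aux hmono k (k + i) (by omega) (by omega) (p i - p (i - 1))
          ((Polynomial.natDegree_sub_le _ _).trans (max_le
            (hdeg i (Finset.mem_range.2 (by omega)))
            (hdeg (i - 1) (Finset.mem_range.2 (by omega)))))
          (by
            intro r hr
            rw [Polynomial.eval_sub, sub_eq_zero]
            exact (hm r hr).symm)
        exact ⟨c, fun _ => hc⟩
      · exact ⟨0, fun h => absurd h hmem⟩
    choose cj hcj using hj
    obtain ⟨c0, hc0⟩ := newton_aux x k (k + 1) le_rfl (p 0)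
      (by
        have := hdeg 0 (Finset.mem_range.2 (by omega))
        exact (Polynomial.degree_le_of_natDegree_le this).trans_lt
          (by exact_mod_cast Nat.lt_succ_self k))
    let c : ℕ → ℝ := fun j => if j ≤ k + 1 then c0 j else cj (j - k - 1)
    have hp : ∀ i, i ≤ n - k - 1 → ffSum x k c (k + 1 + i) = p i := by
      intro i
      induction i with
      | zero =>
        intro _
        rw [hc0]
        unfold ffSum
        refine Finset.sum_congr rfl ?_
        intro j hj
        rw [Finset.mem_Icc] at hj
        simp only [c]
        rw [if_pos (by omega)]
      | succ i ih =>
        intro h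
        rw [show k + 1 + (i + 1) = (k + 1 + i) + 1 by omega, ffSum_succ, ih (by omega)]
        have h1 := hcj (i + 1) (Finset.mem_Icc.2 (by omega))
        have h2 : c (k + 1 + i + 1) = cj (i + 1) := by
          simp only [c]
          rw [if_neg (by omega)]
          congr 1
          omega
        rw [h2, show k + 1 + i + 1 = k + (i + 1) + 1 by omega, ← h1]
        simp
    refine ⟨c, ?_⟩
    intro t ht
    by_cases htk : t ≤ x (k + 1)
    · rw [h0 t ⟨ht.1, htk⟩, ← hp 0 (by omega)]
      symm
      refine ff_piece x k n (k + 1 + 0) c t (by omega) (by omega) ?_ ?_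
      · intro j h1 h2; omega
      · intro j h1 h2
        exact htk.trans (x_mono hmono _ _ (by omega) (by omega) (by omega))
    · push Not at htk
      classical
      let i := Nat.findGreatest (fun i => x (k + i) < t) (n - k - 1)
      have hi1 : 1 ≤ i := Nat.le_findGreatest (by omega) htk
      have hi2 : i ≤ n - k - 1 := Nat.findGreatest_le _
      have hi3 : x (k + i) < t :=
        Nat.findGreatest_spec (P := fun i => x (k + i) < t) (m := 1) (by omega) htk
      have hi4 : i ≠ n - k - 1 → t ≤ x (k + i + 1) := by
        intro h
        have := Nat.findGreatest_is_greatest (P := fun i => x (k + i) < t) (n := n - k - 1)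
          (k := i + 1) (Nat.lt_succ_self _) (by omega)
        exact not_lt.1 this
      rw [hi i (Finset.mem_Icc.2 ⟨hi1, hi2⟩) t ⟨hi3, ?_⟩, ← hp i hi2]
      · symm
        refine ff_piece x k n (k + 1 + i) c t (by omega) (by omega) ?_ ?_
        · intro j h1 h2
          exact (x_mono hmono _ _ (by omega) (by omega) (by omega)).trans_lt hi3
        · intro j h1 h2
          exact (hi4 (by omega)).trans (x_mono hmono _ _ (by omega) (by omega) (by omega))
      · split_ifs with h
        · exact ht.2
        · exact hi4 h
  · intro c hc j
    induction j using Nat.strong_induction_on with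
    | _ j ih =>
      intro hj
      have hj' := Finset.mem_Icc.1 hj
      have h := hc (x j) ⟨ha.trans (x_mono hmono 1 j le_rfl hj'.1 hj'.2),
        (x_mono hmono j n hj'.1 hj'.2 le_rfl).trans hb⟩
      rw [Finset.sum_eq_single_of_mem j hj] at h
      · exact (mul_eq_zero.1 h).resolve_right (ff_diag hmono k j hj'.1 hj'.2)
      · intro i hi hij
        have hi' := Finset.mem_Icc.1 hi
        rcases lt_or_gt_of_ne hij with h1 | h1
        · rw [ih i h1 hi, zero_mul]
        · rw [ff_upper hmono k j i hj'.1 h1 hi'.2, mul_zero]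
end

section
/- Dual basis to the falling factorial basis: let k ≥ 0 and n ≥ k+2. Define linear functionals λ^k_i on functions on [a,b] by λ^k_i f = (Δ^{k+1}_n f)(x_i) for i = 1,…,k+1, and λ^k_i f = (Δ^{k+1}_n f)(x_i)·(x_i − x_{i−k−1})/(k+1) for i = k+2,…,n. Then for all i, j ∈ {1,…,n}, λ^k_i h^k_j = 1 if i = j and λ^k_i h^k_j = 0 otherwise. -/
open Finset

theorem aux_cons (f : ℝ → ℝ) (z : ℝ) (l : List ℝ) (h : l ≠ []) :
    divDiff f (z :: l) = (divDiff f l - divDiff f (z :: l.dropLast)) / (l.getLast h - z) := by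
  cases l with
  | nil => exact absurd rfl h
  | cons y l => rw [divDiff]

theorem aux_ctrs_snoc (x : ℕ → ℝ) (lo d : ℕ) :
    ctrs x lo (lo + d) = (List.range d).map (fun m => x (lo + m)) ++ [x (lo + d)] := by
  have : lo + d + 1 - lo = d + 1 := by omega
  simp [ctrs, this, List.range_succ]

theorem aux_ctrs_cons (x : ℕ → ℝ) (lo d : ℕ) :
    ctrs x lo (lo + (d + 1)) = x lo :: ctrs x (lo + 1) (lo + 1 + d) := by
  have h1 : lo + (d + 1) + 1 - lo = (d + 1) + 1 := by omega
  have h2 : lo + 1 + d + 1 - (lo + 1) = d + 1 := by omega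
  simp only [ctrs, h1, h2]
  rw [List.range_succ_eq_map, List.map_cons, List.map_map]
  congr 1
  apply List.map_congr_left
  intro m _
  simp only [Function.comp]
  congr 1
  omega

theorem aux_conv (f : ℝ → ℝ) (x : ℕ → ℝ) (d : ℕ) : ∀ lo,
    divDiff f (ctrs x lo (lo + d)) = divDiffVec x (fun i => f (x i)) lo d := by
  induction d with
  | zero => intro lo; simp [ctrs, divDiff, divDiffVec]
  | succ d ih =>
    intro lo
    have hne : ctrs x (lo + 1) (lo + 1 + d) ≠ [] := by
      rw [aux_ctrs_snoc]; simp
    have hlast : (ctrs x (lo + 1) (lo + 1 + d)).getLast hne = x (lo + d + 1) := by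
      simp only [aux_ctrs_snoc, List.getLast_append_singleton]
      congr 1; omega
    have hdrop : x lo :: (ctrs x (lo + 1) (lo + 1 + d)).dropLast = ctrs x lo (lo + d) := by
      rw [← List.dropLast_cons_of_ne_nil hne, ← aux_ctrs_cons, aux_ctrs_snoc,
        List.dropLast_concat, ctrs]
      congr 2; omega
    rw [aux_ctrs_cons, aux_cons _ _ _ hne, hlast, hdrop, ih, ih, divDiffVec]

theorem aux_congr (x v w : ℕ → ℝ) (d : ℕ) : ∀ lo, (∀ i, lo ≤ i → i ≤ lo + d → v i = w i) →
    divDiffVec x v lo d = divDiffVec x w lo d := by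
  induction d with
  | zero => intro lo h; simpa [divDiffVec] using h lo le_rfl le_rfl
  | succ d ih =>
    intro lo h
    rw [divDiffVec, divDiffVec, ih lo (fun i _ _ => h i (by omega) (by omega)),
      ih (lo + 1) (fun i _ _ => h i (by omega) (by omega))]

theorem aux_smul (x v : ℕ → ℝ) (c : ℝ) (d : ℕ) : ∀ lo,
    divDiffVec x (fun i => c * v i) lo d = c * divDiffVec x v lo d := by
  induction d with
  | zero => intro lo; simp [divDiffVec]
  | succ d ih =>
    intro lo
    rw [divDiffVec, divDiffVec, ih, ih]; ring

theorem aux_zero (x v : ℕ → ℝ) (d lo : ℕ) (h : ∀ i, lo ≤ i → i ≤ lo + d → v i = 0) :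
    divDiffVec x v lo d = 0 := by
  rw [aux_congr x v (fun i => 0 * v i) d lo (fun i h1 h2 => by simp [h i h1 h2]), aux_smul]
  simp

theorem aux_leibniz (n : ℕ) (x g : ℕ → ℝ) (c : ℝ)
    (hx : ∀ i j, 1 ≤ i → i < j → j ≤ n → x i < x j) (d : ℕ) : ∀ lo, 1 ≤ lo → lo + d + 1 ≤ n →
    divDiffVec x (fun i => (x i - c) * g i) lo (d + 1) =
      (x (lo + d + 1) - c) * divDiffVec x g lo (d + 1) + divDiffVec x g lo d := by
  induction d with
  | zero =>
    intro lo h1 h2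
    have := hx lo (lo + 1) h1 (by omega) h2
    have h : x (lo + 1) - x lo ≠ 0 := by linarith
    simp only [divDiffVec, Nat.add_zero]
    field_simp
    ring
  | succ d ih =>
    intro lo h1 h2
    have h := hx lo (lo + d + 1) h1 (by omega) (by omega)
    have h' := hx lo (lo + (d + 1) + 1) h1 (by omega) (by omega)
    have e1 : x (lo + d + 1) - x lo ≠ 0 := by linarith
    have e2 : x (lo + (d + 1) + 1) - x lo ≠ 0 := by linarith
    have hG : divDiffVec x g (lo + 1) d - divDiffVec x g lo d =
        (x (lo + d + 1) - x lo) * divDiffVec x g lo (d + 1) := by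
      rw [divDiffVec]; field_simp
    have e3 : lo + 1 + d + 1 = lo + (d + 1) + 1 := by omega
    have hL : divDiffVec x g lo (d + 1 + 1) = (divDiffVec x g (lo + 1) (d + 1) -
      divDiffVec x g lo (d + 1)) / (x (lo + (d + 1) + 1) - x lo) := by rw [divDiffVec]
    rw [divDiffVec, ih lo h1 (by omega), ih (lo + 1) (by omega) (by omega), e3, hL]
    rw [div_eq_iff e2, add_mul, mul_assoc, div_mul_cancel₀ _ e2]
    linear_combination hG

theorem aux_prod (n : ℕ) (x : ℕ → ℝ)
    (hx : ∀ i j, 1 ≤ i → i < j → j ≤ n → x i < x j) (s : Finset ℕ) :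
    ∀ lo d, 1 ≤ lo → lo + d ≤ n → s.card ≤ d →
    divDiffVec x (fun i => ∏ l ∈ s, (x i - x l)) lo d = if d = s.card then 1 else 0 := by
  induction s using Finset.induction_on with
  | empty =>
    intro lo d
    induction d generalizing lo with
    | zero => intros; simp [divDiffVec]
    | succ d ih =>
      intro h1 h2 _
      rw [divDiffVec, ih lo h1 (by omega) (by simp), ih (lo + 1) (by omega) (by omega) (by simp)]
      simp
  | insert a s ha ih =>
    intro lo d h1 h2 h3
    rw [Finset.card_insert_of_notMem ha] at *
    obtain ⟨d, rfl⟩ : ∃ e, d = e + 1 := ⟨d - 1, by omega⟩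
    simp only [Finset.prod_insert ha]
    rw [aux_leibniz n x _ _ hx d lo h1 (by omega), ih lo (d + 1) h1 h2 (by omega),
      ih lo d h1 (by omega) (by omega)]
    rw [if_neg (by omega)]
    simp

theorem aux_idx (n : ℕ) (x : ℕ → ℝ)
    (hx : ∀ i j, 1 ≤ i → i < j → j ≤ n → x i < x j) (i : ℕ) (h1 : 1 ≤ i) (h2 : i ≤ n) :
    discrIdx x n (x i) = i - 1 := by
  have : (Finset.Icc 1 n).filter (fun j => x j < x i) = Finset.Icc 1 (i - 1) := by
    ext j
    simp only [Finset.mem_filter, Finset.mem_Icc]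
    constructor
    · rintro ⟨⟨a, b⟩, c⟩
      refine ⟨a, ?_⟩
      by_contra hh
      rcases eq_or_lt_of_le (show i ≤ j by omega) with e | e
      · subst e; exact lt_irrefl _ c
      · exact lt_asymm c (hx i j h1 e b)
    · rintro ⟨a, b⟩
      exact ⟨⟨a, by omega⟩, hx j i a (by omega) h2⟩
  rw [discrIdx, this]; simp

theorem aux_snoc' (x : ℕ → ℝ) (lo i : ℕ) (h1 : 1 ≤ i) (h : lo ≤ i) :
    ctrs x lo (i - 1) ++ [x i] = ctrs x lo (lo + (i - lo)) := by
  rw [aux_ctrs_snoc, ctrs]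
  have e1 : i - 1 + 1 - lo = i - lo := by omega
  have e2 : lo + (i - lo) = i := by omega
  rw [e1, e2]

/-- Lemma: dual basis to the falling factorial basis.  With
`λ^k_i f = (Δ^{k+1}_n f)(x_i)` for `i = 1,…,k+1` and
`λ^k_i f = (Δ^{k+1}_n f)(x_i)·(x_i − x_{i−k−1})/(k+1)` for `i = k+2,…,n`, one has
`λ^k_i h^k_j = δ_{ij}` for all `i, j ∈ {1,…,n}`. -/
theorem fallFact_dual_basis
    (n k : ℕ) (a b : ℝ) (x : ℕ → ℝ)
    (hn : k + 2 ≤ n)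
    (hmono : ∀ i, 1 ≤ i → i < n → x i < x (i + 1))
    (ha : a ≤ x 1) (hb : x n ≤ b) (hab : x (n + 1) = b) :
    ∀ i ∈ Finset.Icc 1 n, ∀ j ∈ Finset.Icc 1 n,
      (if i ≤ k + 1 then discreteDeriv x n (k + 1) (fallFact x k j) (x i)
        else discreteDeriv x n (k + 1) (fallFact x k j) (x i) *
          ((x i - x (i - (k + 1))) / (k + 1)))
        = if i = j then 1 else 0 := by
  have hx : ∀ i j, 1 ≤ i → i < j → j ≤ n → x i < x j := by
    intro i j h1 hij
    induction j, hij using Nat.le_induction with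
    | base => intro h; exact hmono i h1 (by omega)
    | succ j hj ih =>
      intro h
      exact (ih (by omega)).trans (hmono j (by omega) (by omega))
  have hxle : ∀ i j, 1 ≤ i → i ≤ j → j ≤ n → x i ≤ x j := by
    intro i j h1 h2 h3
    rcases eq_or_lt_of_le h2 with e | e
    · rw [e]
    · exact (hx i j h1 e h3).le
  intro i hi j hj
  rw [Finset.mem_Icc] at hi hj
  obtain ⟨hi1, hin⟩ := hi
  obtain ⟨hj1, hjn⟩ := hj
  have hidx := aux_idx n x hx i hi1 hin
  have hfact : ∀ m : ℕ, (Nat.factorial m : ℝ) ≠ 0 := fun m => by positivity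
  -- the truncated functions vanish at points with small index
  have hvan : ∀ m, 1 ≤ m → m < j → fallFact x k j (x m) = 0 := by
    intro m hm1 hmj
    by_cases hjk : j ≤ k + 1
    · rw [fallFact, if_pos hjk,
        Finset.prod_eq_zero (i := m) (by rw [Finset.mem_Icc]; omega) (sub_self _), mul_zero]
    · rw [fallFact, if_neg hjk, if_neg (not_lt.mpr (hxle m (j - 1) hm1 (by omega) (by omega))),
        mul_zero]
  by_cases hik : i ≤ k + 1
  · rw [if_pos hik]
    simp only [discreteDeriv, hidx]
    rw [if_neg (by omega), aux_snoc' x 1 i hi1 hi1, aux_conv]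
    by_cases hij : i < j
    · rw [if_neg (by omega), aux_zero, mul_zero]
      intro m h1 h2
      exact hvan m h1 (by omega)
    · simp only [fallFact, if_pos (show j ≤ k + 1 by omega)]
      rw [aux_smul, aux_prod n x hx _ 1 (i - 1) le_rfl (by omega) (by simp; omega)]
      simp only [Nat.card_Icc]
      by_cases e : i = j
      · subst e
        have := hfact (i - 1)
        simp [this]
      · rw [if_neg (by omega), if_neg e]; simp
  · rw [if_neg hik]
    simp only [discreteDeriv, hidx]
    have e0 : i - 1 + 1 - (k + 1) = i - (k + 1) := by omega
    have e0' : i - (i - (k + 1)) = k + 1 := by omega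
    rw [if_pos (by omega), e0, aux_snoc' x (i - (k + 1)) i hi1 (by omega), aux_conv, e0']
    rcases lt_trichotomy i j with hij | hij | hij
    · rw [if_neg (by omega), aux_zero, mul_zero, zero_mul]
      intro m h1 h2
      exact hvan m (by omega) (by omega)
    · subst hij
      rw [if_pos rfl, divDiffVec]
      have e1 : i - (k + 1) + k + 1 = i := by omega
      have e2 : i - (k + 1) + 1 = i - k := by omega
      rw [e1, e2, aux_zero x _ k (i - (k + 1)) (fun m h1 h2 => hvan m (by omega) (by omega))]
      rw [aux_congr x _ (fun m => (1 / (Nat.factorial k : ℝ)) *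
        ∏ l ∈ Finset.Icc (i - k) (i - 1), (x m - x l)) k (i - k), aux_smul,
        aux_prod n x hx _ (i - k) k (by omega) (by omega) (by simp; omega)]
      · have e3 : k = (Finset.Icc (i - k) (i - 1)).card := by simp; omega
        rw [if_pos e3]
        have := hx (i - (k + 1)) i (by omega) (by omega) hin
        have e4 : x i - x (i - (k + 1)) ≠ 0 := by linarith
        have := hfact k
        have e5 : (k : ℝ) + 1 ≠ 0 := by positivity
        rw [Nat.factorial_succ]
        push_cast
        field_simp
        simp
      · intro m h1 h2
        by_cases hm : m = i
        · subst hm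
          rw [fallFact, if_neg hik, if_pos (hx _ _ (by omega) (by omega) hin), mul_one]
        · rw [hvan m (by omega) (by omega),
            Finset.prod_eq_zero (i := m) (by rw [Finset.mem_Icc]; omega) (sub_self _), mul_zero]
    · rw [if_neg (by omega)]
      by_cases hjk : j ≤ k + 1
      · simp only [fallFact, if_pos hjk]
        rw [aux_smul, aux_prod n x hx _ _ _ (by omega) (by omega) (by simp; omega),
          if_neg (by simp; omega)]
        simp
      · rw [aux_congr x _ (fun m => (1 / (Nat.factorial k : ℝ)) *
          ∏ l ∈ Finset.Icc (j - k) (j - 1), (x m - x l)) (k + 1) _, aux_smul,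
          aux_prod n x hx _ _ _ (by omega) (by omega) (by simp; omega), if_neg (by simp; omega)]
        · simp
        · intro m h1 h2
          by_cases hm : m < j
          · rw [hvan m (by omega) hm,
              Finset.prod_eq_zero (i := m) (by rw [Finset.mem_Icc]; omega) (sub_self _), mul_zero]
          · rw [fallFact, if_neg hjk, if_pos (hx _ _ (by omega) (by omega) (by omega)), mul_one]
end

section
/- Falling factorial interpolation (generalized Newton formula): let k ≥ 0 and n ≥ k+2, and let y_1, …, y_n be arbitrary real numbers. There is a unique f ∈ H^k_n with f(x_i) = y_i for i = 1,…,n, and it satisfies, for all x ∈ [a,b], f(x) = Σ_{i=1}^{k+1} f[x_1,…,x_i]·η(x; x_{1:(i−1)}) + Σ_{i=k+2}^n f[x_{i−k−1},…,x_i]·(x_i − x_{i−k−1})·η₊(x; x_{(i−k):(i−1)}), where the divided differences of f depend only on the values y_1,…,y_n. -/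
open Finset

noncomputable def newtP (x y : ℕ → ℝ) (s d : ℕ) (t : ℝ) : ℝ :=
  ∑ j ∈ range (d + 1), divDiffVec x y s j * ∏ l ∈ range j, (t - x (s + l))

lemma newtP_succ (x y : ℕ → ℝ) (s d : ℕ) (t : ℝ) :
    newtP x y s (d + 1) t = newtP x y s d t +
      divDiffVec x y s (d + 1) * ((t - x s) * ∏ l ∈ range d, (t - x (s + 1 + l))) := by
  unfold newtP
  rw [sum_range_succ _ (d + 1), prod_range_succ' _ d]
  have : ∏ l ∈ range d, (t - x (s + (l + 1))) = ∏ l ∈ range d, (t - x (s + 1 + l)) :=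
    prod_congr rfl fun l _ => by rw [show s + (l + 1) = s + 1 + l by omega]
  rw [this, add_zero]
  ring

lemma newtP_zero (x y : ℕ → ℝ) (s : ℕ) (t : ℝ) : newtP x y s 0 t = y s := by
  simp [newtP, divDiffVec]

lemma dd_succ (x y : ℕ → ℝ) (s d : ℕ) (h : x s < x (s + d + 1)) :
    divDiffVec x y (s + 1) d - divDiffVec x y s d =
      divDiffVec x y s (d + 1) * (x (s + d + 1) - x s) := by
  have : x (s + d + 1) - x s ≠ 0 := by linarith
  rw [divDiffVec]
  field_simp

lemma newtP_shift (x y : ℕ → ℝ) (n : ℕ) (hx : ∀ i j, 1 ≤ i → i < j → j ≤ n → x i < x j)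
    (s : ℕ) (hs : 1 ≤ s) (d : ℕ) (hd : s + d ≤ n) (t : ℝ) :
    newtP x y (s + 1) d t - newtP x y s d t =
      (divDiffVec x y (s + 1) d - divDiffVec x y s d) * ∏ l ∈ range d, (t - x (s + 1 + l)) := by
  induction d with
  | zero => simp [newtP_zero, divDiffVec]
  | succ d ih =>
    have ih := ih (by omega)
    rw [dd_succ x y s d (hx _ _ hs (by omega) (by omega))] at ih
    have e : newtP x y (s + 1) (d + 1) t = newtP x y (s + 1) d t +
        divDiffVec x y (s + 1) (d + 1) * ∏ l ∈ range (d + 1), (t - x (s + 1 + l)) := by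
      unfold newtP
      rw [sum_range_succ _ (d + 1)]
    rw [e, newtP_succ x y s d, prod_range_succ]
    have h2 : s + 1 + d = s + d + 1 := by omega
    rw [h2]
    linear_combination ih

lemma newtP_interp (x y : ℕ → ℝ) (n : ℕ) (hx : ∀ i j, 1 ≤ i → i < j → j ≤ n → x i < x j)
    (d : ℕ) : ∀ (s : ℕ) (_ : 1 ≤ s) (_ : s + d ≤ n) (j : ℕ) (_ : j ≤ d),
    newtP x y s d (x (s + j)) = y (s + j) := by
  induction d with
  | zero => intro s _ _ j hj; obtain rfl : j = 0 := by omega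
            simp [newtP_zero]
  | succ d ih =>
    intro s hs hd j hj
    rw [newtP_succ]
    rcases Nat.lt_or_ge d j with h | h
    · obtain rfl : j = d + 1 := by omega
      have h1 := newtP_shift x y n hx s hs d (by omega) (x (s + (d + 1)))
      rw [dd_succ x y s d (hx _ _ hs (by omega) (by omega))] at h1
      have h2 := ih (s + 1) (by omega) (by omega) d le_rfl
      have h3 : s + 1 + d = s + (d + 1) := by omega
      rw [h3] at h2
      have h4 : s + d + 1 = s + (d + 1) := by omega
      rw [h4] at h1
      linear_combination h2 - h1
    · rw [ih s hs (by omega) j h]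
      rcases Nat.eq_zero_or_pos j with rfl | hj0
      · simp
      · rw [prod_eq_zero (i := j - 1) (by simp; omega)]
        · simp
        · have : s + 1 + (j - 1) = s + j := by omega
          rw [this, sub_self]

lemma prod_shift (x : ℕ → ℝ) (t : ℝ) (s d e : ℕ) (he : e + 1 = s + d) :
    ∏ l ∈ Icc s e, (t - x l) = ∏ l ∈ range d, (t - x (s + l)) := by
  have : Icc s e = Ico s (s + d) := by ext; simp; omega
  rw [this, prod_Ico_eq_prod_range]
  simp

lemma newt_first (x y : ℕ → ℝ) (k : ℕ) (t : ℝ) :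
    ∑ i ∈ Icc 1 (k + 1), divDiffVec x y 1 (i - 1) * ∏ l ∈ Icc 1 (i - 1), (t - x l)
      = newtP x y 1 k t := by
  have : Icc 1 (k + 1) = Ico 1 (k + 2) := by ext; simp; omega
  rw [this, sum_Ico_eq_sum_range]
  unfold newtP
  refine sum_congr (by simp) fun i _ => ?_
  rw [prod_shift x t 1 i _ (by omega)]
  simp

lemma newt_second (x y : ℕ → ℝ) (n : ℕ) (hx : ∀ i j, 1 ≤ i → i < j → j ≤ n → x i < x j)
    (k m : ℕ) (t : ℝ) (hm : k + 1 ≤ m) (hmn : m ≤ n) :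
    ∑ i ∈ Icc (k + 2) m, divDiffVec x y (i - (k + 1)) (k + 1) * (x i - x (i - (k + 1))) *
      (∏ l ∈ Icc (i - k) (i - 1), (t - x l)) = newtP x y (m - k) k t - newtP x y 1 k t := by
  induction m, hm using Nat.le_induction with
  | base => simp
  | succ m hm ih =>
    rw [Finset.sum_Icc_succ_top (by omega), ih (by omega)]
    obtain ⟨s, rfl⟩ : ∃ s, m = s + k := ⟨m - k, by omega⟩
    have e1 : s + k + 1 - (k + 1) = s := by omega
    have e2 : s + k + 1 - k = s + 1 := by omega
    have e3 : s + k - k = s := by omega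
    rw [e1, e2, e3, prod_shift x t (s + 1) k _ (by omega),
      ← dd_succ x y s k (hx _ _ (by omega) (by omega) (by omega)),
      ← newtP_shift x y n hx s (by omega) k (by omega)]
    ring

lemma ff_zero (x : ℕ → ℝ) (n : ℕ) (hx : ∀ i j, 1 ≤ i → i < j → j ≤ n → x i < x j)
    (k i j : ℕ) (hi : 1 ≤ i) (hij : i < j) (hj : j ≤ n) : fallFact x k j (x i) = 0 := by
  unfold fallFact
  split_ifs with h1 h2
  · rw [prod_eq_zero (i := i) (by simp; omega) (sub_self _)]; simp
  · exfalso
    rcases Nat.lt_or_ge i (j - 1) with h | h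
    · linarith [hx i (j - 1) hi h (by omega)]
    · obtain rfl : i = j - 1 := by omega
      exact lt_irrefl _ h2
  · simp

lemma ff_ne (x : ℕ → ℝ) (n : ℕ) (hx : ∀ i j, 1 ≤ i → i < j → j ≤ n → x i < x j)
    (k j : ℕ) (hj1 : 1 ≤ j) (hj : j ≤ n) : fallFact x k j (x j) ≠ 0 := by
  have hf : ∀ m : ℕ, (1 / (Nat.factorial m : ℝ)) ≠ 0 := fun m => by positivity
  have hp : ∀ s, 1 ≤ s → ∏ l ∈ Icc s (j - 1), (x j - x l) ≠ 0 := by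
    intro s hs
    refine prod_ne_zero_iff.2 fun l hl => ?_
    rw [mem_Icc] at hl
    have := hx l j (by omega) (by omega) hj
    linarith
  unfold fallFact
  split_ifs with h1 h2
  · exact mul_ne_zero (hf _) (hp _ le_rfl)
  · exact mul_ne_zero (mul_ne_zero (hf _) (hp _ (by omega))) one_ne_zero
  · exact absurd (hx (j - 1) j (by omega) (by omega) hj) h2

lemma ff_unique (x : ℕ → ℝ) (n : ℕ) (hx : ∀ i j, 1 ≤ i → i < j → j ≤ n → x i < x j)
    (k : ℕ) (c : ℕ → ℝ)
    (h : ∀ i ∈ Icc 1 n, ∑ j ∈ Icc 1 n, c j * fallFact x k j (x i) = 0) :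
    ∀ i, i ∈ Icc 1 n → c i = 0 := by
  intro i
  induction i using Nat.strong_induction_on with
  | _ i ih =>
    intro hi
    have h0 := h i hi
    have hi' := mem_Icc.1 hi
    rw [sum_eq_single_of_mem i hi] at h0
    · exact (mul_eq_zero.1 h0).resolve_right (ff_ne x n hx k i hi'.1 hi'.2)
    · intro j hj hne
      have hj' := mem_Icc.1 hj
      rcases Nat.lt_or_ge j i with hlt | hge
      · rw [ih j hlt hj, zero_mul]
      · rw [ff_zero x n hx k i j hi'.1 (by omega) hj'.2, mul_zero]

/-- Theorem: falling factorial interpolation, generalizing Newton's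
divided-difference interpolation formula.  Given arbitrary values `y_1,…,y_n`, there is
a unique interpolant `f ∈ H^k_n` with `f(x_i) = y_i`, and for all `x ∈ [a,b]`,
`f(x) = Σ_{i=1}^{k+1} f[x_1,…,x_i]·η(x; x_{1:(i−1)})
 + Σ_{i=k+2}^n f[x_{i−k−1},…,x_i]·(x_i − x_{i−k−1})·η₊(x; x_{(i−k):(i−1)})`,
where the divided differences of `f` only depend on `y` (they are `divDiffVec x y · ·`). -/
theorem fallFact_interpolation
    (n k : ℕ) (a b : ℝ) (x : ℕ → ℝ)
    (hn : k + 2 ≤ n)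
    (hmono : ∀ i, 1 ≤ i → i < n → x i < x (i + 1))
    (ha : a ≤ x 1) (hb : x n ≤ b) (hab : x (n + 1) = b)
    (y : ℕ → ℝ) :
    ∃ f : ℝ → ℝ,
      inFFSpan x n k a b f ∧
      (∀ i ∈ Finset.Icc 1 n, f (x i) = y i) ∧
      (∀ g : ℝ → ℝ, inFFSpan x n k a b g → (∀ i ∈ Finset.Icc 1 n, g (x i) = y i) →
        ∀ t ∈ Set.Icc a b, g t = f t) ∧
      (∀ t ∈ Set.Icc a b,
        f t =
          (∑ i ∈ Finset.Icc 1 (k + 1),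
            divDiffVec x y 1 (i - 1) * ∏ ℓ ∈ Finset.Icc 1 (i - 1), (t - x ℓ))
          + ∑ i ∈ Finset.Icc (k + 2) n,
              divDiffVec x y (i - (k + 1)) (k + 1) * (x i - x (i - (k + 1))) *
                ((∏ ℓ ∈ Finset.Icc (i - k) (i - 1), (t - x ℓ)) *
                  (if x (i - 1) < t then 1 else 0))) := by
  have hx : ∀ i j, 1 ≤ i → i < j → j ≤ n → x i < x j := by
    intro i j hi hij hj
    induction j, hij using Nat.le_induction with
    | base => exact hmono i hi (by omega)
    | succ j hij ih => exact (ih (by omega)).trans (hmono j (by omega) (by omega))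
  have hle : ∀ i j, 1 ≤ i → i ≤ j → j ≤ n → x i ≤ x j := by
    intro i j hi hij hj
    rcases hij.eq_or_lt with rfl | h
    · exact le_rfl
    · exact (hx i j hi h hj).le
  refine ⟨fun t => (∑ i ∈ Finset.Icc 1 (k + 1),
            divDiffVec x y 1 (i - 1) * ∏ ℓ ∈ Finset.Icc 1 (i - 1), (t - x ℓ))
          + ∑ i ∈ Finset.Icc (k + 2) n,
              divDiffVec x y (i - (k + 1)) (k + 1) * (x i - x (i - (k + 1))) *
                ((∏ ℓ ∈ Finset.Icc (i - k) (i - 1), (t - x ℓ)) *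
                  (if x (i - 1) < t then 1 else 0)), ?_⟩
  generalize hF : (fun t => (∑ i ∈ Finset.Icc 1 (k + 1),
            divDiffVec x y 1 (i - 1) * ∏ ℓ ∈ Finset.Icc 1 (i - 1), (t - x ℓ))
          + ∑ i ∈ Finset.Icc (k + 2) n,
              divDiffVec x y (i - (k + 1)) (k + 1) * (x i - x (i - (k + 1))) *
                ((∏ ℓ ∈ Finset.Icc (i - k) (i - 1), (t - x ℓ)) *
                  (if x (i - 1) < t then 1 else 0))) = F
  have hspan : inFFSpan x n k a b F := by
    refine ⟨fun j => if j ≤ k + 1 then divDiffVec x y 1 (j - 1) * (Nat.factorial (j - 1) : ℝ)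
      else divDiffVec x y (j - (k + 1)) (k + 1) * (x j - x (j - (k + 1))) *
        (Nat.factorial k : ℝ), fun t _ => ?_⟩
    have hU : Icc 1 n = Icc 1 (k + 1) ∪ Icc (k + 2) n := by ext; simp; omega
    rw [hU, sum_union (by rw [disjoint_left]; intro i; simp; omega), ← hF]
    refine congrArg₂ (· + ·) (sum_congr rfl fun i hi => ?_) (sum_congr rfl fun i hi => ?_)
    · have := (mem_Icc.1 hi).2
      have h0 : (Nat.factorial (i - 1) : ℝ) ≠ 0 := by positivity
      unfold fallFact
      beta_reduce
      rw [if_pos this, if_pos this]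
      field_simp
    · have : ¬ i ≤ k + 1 := by have := (mem_Icc.1 hi).1; omega
      have h0 : (Nat.factorial k : ℝ) ≠ 0 := by positivity
      unfold fallFact
      beta_reduce
      rw [if_neg this, if_neg this]
      generalize (if x (i - 1) < t then (1 : ℝ) else 0) = q
      field_simp
  have hint : ∀ i ∈ Finset.Icc 1 n, F (x i) = y i := by
    intro m hm
    obtain ⟨hm1, hmn⟩ := mem_Icc.1 hm
    rw [← hF]
    simp only
    rw [newt_first]
    rcases Nat.lt_or_ge (k + 1) m with h | h
    · have hsub : Icc (k + 2) m ⊆ Icc (k + 2) n := Icc_subset_Icc_right hmn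
      rw [← sum_subset hsub]
      · have h2 := newt_second x y n hx k m (x m) (by omega) hmn
        have h3 := newtP_interp x y n hx k (m - k) (by omega) (by omega) k le_rfl
        rw [Nat.sub_add_cancel (by omega)] at h3
        rw [h3] at h2
        rw [sum_congr rfl (g := fun i => divDiffVec x y (i - (k + 1)) (k + 1) *
          (x i - x (i - (k + 1))) * (∏ l ∈ Icc (i - k) (i - 1), (x m - x l))), h2]
        · ring
        · intro i hi
          have hi := mem_Icc.1 hi
          rw [if_pos (hx _ _ (by omega) (by omega) hmn), mul_one]
      · intro i hi hi2
        rw [mem_Icc] at hi hi2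
        rw [if_neg (not_lt.2 (hle _ _ hm1 (by omega) (by omega)))]
        simp
    · rw [sum_eq_zero, add_zero]
      · have h3 := newtP_interp x y n hx k 1 le_rfl (by omega) (m - 1) (by omega)
        rwa [Nat.add_sub_cancel' hm1] at h3
      · intro i hi
        rw [mem_Icc] at hi
        rw [if_neg (not_lt.2 (hle _ _ hm1 (by omega) (by omega)))]
        simp
  refine ⟨hspan, hint, ?_, fun t _ => by rw [← hF]⟩
  rintro g ⟨c, hc⟩ hg t ht
  obtain ⟨c', hc'⟩ := hspan
  have key := ff_unique x n hx k (fun j => c j - c' j) (by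
    intro i hi
    have hi' := mem_Icc.1 hi
    have hmem : x i ∈ Set.Icc a b :=
      ⟨ha.trans (hle _ _ le_rfl hi'.1 hi'.2), (hle _ _ hi'.1 hi'.2 le_rfl).trans hb⟩
    have e1 := hc _ hmem
    have e2 := hc' _ hmem
    rw [hg i hi] at e1
    rw [hint i hi] at e2
    simp only [sub_mul, sum_sub_distrib]
    linarith)
  rw [hc t ht, hc' t ht]
  exact sum_congr rfl fun j hj => by rw [sub_eq_zero.1 (key j hj)]
end

section
/- Implicit interpolation formula for discrete splines: let k ≥ 0, n ≥ k+2, and f ∈ H^k_n. For every x ∈ [a,b] with x ∉ {x_1,…,x_n}: if x > x_{k+1} and i is the smallest index such that x_i > x (with i = n when x > x_n), then f[x_{i−k}, …, x_i, x] = 0; and if x < x_{k+1}, then f[x_1, …, x_{k+1}, x] = 0. In each case this is a linear equation in the single unknown f(x) with nonzero coefficient on f(x), and hence uniquely determines f(x) from at most k+1 of the values f(x_1),…,f(x_n). -/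
open Finset

theorem divDiff_snoc (f : ℝ → ℝ) (z t : ℝ) (l : List ℝ) :
    divDiff f (z :: (l ++ [t])) = (divDiff f (l ++ [t]) - divDiff f (z :: l)) / (t - z) := by
  cases l with
  | nil => simp [divDiff]
  | cons y l =>
    have h1 : (y :: (l ++ [t])).dropLast = y :: l := by
      rw [← List.cons_append, List.dropLast_concat]
    have h2 : (y :: (l ++ [t])).getLast (List.cons_ne_nil _ _) = t := by
      simp
    rw [List.cons_append, divDiff, h1, h2]

theorem divDiff_congr_s9 (f g : ℝ → ℝ) : ∀ (m : ℕ) (l : List ℝ), l.length = m →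
    (∀ w ∈ l, f w = g w) → divDiff f l = divDiff g l := by
  intro m
  induction m with
  | zero =>
    intro l hl _
    rw [List.length_eq_zero_iff] at hl
    subst hl
    simp [divDiff]
  | succ m ih =>
    intro l hl h
    cases l with
    | nil => simp at hl
    | cons z l =>
      rcases List.eq_nil_or_concat l with rfl | ⟨l', t, rfl⟩
      · simpa [divDiff] using h
      · rw [List.concat_eq_append] at *
        rw [divDiff_snoc, divDiff_snoc]
        simp only [List.length_cons, List.length_append, List.length_nil] at hl
        rw [ih (l' ++ [t]) (by simp; omega) (fun w hw => h w (List.mem_cons_of_mem _ hw)),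
          ih (z :: l') (by simp; omega) (fun w hw => h w (by
            simp only [List.mem_cons, List.mem_append] at hw ⊢; tauto))]

theorem divDiff_sub_last (f g : ℝ → ℝ) (t : ℝ) : ∀ (l : List ℝ),
    (∀ w ∈ l, f w = g w) →
    divDiff f (l ++ [t]) - divDiff g (l ++ [t]) = (f t - g t) / (l.map fun w => t - w).prod := by
  intro l
  induction l with
  | nil => intro _; simp [divDiff]
  | cons z l ih =>
    intro h
    have h1 := ih (fun w hw => h w (List.mem_cons_of_mem _ hw))
    rw [List.cons_append, divDiff_snoc, divDiff_snoc,
      divDiff_congr_s9 f g _ (z :: l) rfl h, ← sub_div, sub_sub_sub_cancel_right, h1,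
      List.map_cons, List.prod_cons, div_div, mul_comm]

open Polynomial in
theorem divDiff_poly : ∀ (m : ℕ) (l : List ℝ) (p : ℝ[X]), l.length = m + 1 → l.Nodup →
    p.natDegree ≤ m → divDiff (fun w => p.eval w) l = p.coeff m := by
  intro m
  induction m with
  | zero =>
    intro l p hl _ hp
    obtain ⟨z, rfl⟩ := List.length_eq_one_iff.1 hl
    rw [Polynomial.eq_C_of_natDegree_le_zero hp]
    simp [divDiff]
  | succ m ih =>
    intro l p hl hnd hp
    cases l with
    | nil => simp at hl
    | cons z l =>
      rcases List.eq_nil_or_concat l with rfl | ⟨l', t, rfl⟩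
      · simp at hl
      · rw [List.concat_eq_append] at *
        simp only [List.length_cons, List.length_append, List.length_nil] at hl
        have hl' : l'.length = m := by omega
        have hzt : t - z ≠ 0 := by
          intro h
          have : t = z := by linarith
          subst this
          simp at hnd
        set c := p.coeff (m + 1) with hc
        set N : ℝ[X] := (l'.map fun w => X - C w).prod with hN
        have hMon : ∀ l'' : List ℝ, ((l''.map fun w => (X - C w : ℝ[X])).prod).Monic := by
          intro l''
          induction l'' with
          | nil => simp
          | cons y l'' ih2 =>
            rw [List.map_cons, List.prod_cons]
            exact (monic_X_sub_C y).mul ih2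
        have hNm : N.Monic := hMon l'
        have hNd : ∀ l'' : List ℝ, ((l''.map fun w => (X - C w : ℝ[X])).prod).natDegree = l''.length := by
          intro l''
          induction l'' with
          | nil => simp
          | cons y l'' ih2 =>
            rw [List.map_cons, List.prod_cons, (monic_X_sub_C y).natDegree_mul', ih2,
              natDegree_X_sub_C, List.length_cons, add_comm]
            exact (hMon l'').ne_zero
        have hNe : ∀ w ∈ l', N.eval w = 0 := by
          intro w hw
          rw [hN, Polynomial.eval_list_prod]
          apply List.prod_eq_zero
          simp only [List.mem_map]
          exact ⟨_, ⟨w, hw, rfl⟩, by simp⟩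
        have hNdeg : N.natDegree = m := by rw [hN, hNd, hl']
        have key : ∀ s : ℝ, (p - C c * (N * (X - C s))).natDegree ≤ m := by
          intro s
          have hd : (N * (X - C s)).natDegree = m + 1 := by
            rw [hNm.natDegree_mul (monic_X_sub_C s), hNdeg, natDegree_X_sub_C]
          rw [Polynomial.natDegree_le_iff_coeff_eq_zero]
          intro q hq
          rw [coeff_sub, coeff_C_mul]
          rcases Nat.lt_or_ge (m + 1) q with h | h
          · rw [coeff_eq_zero_of_natDegree_lt (lt_of_le_of_lt hp h),
              coeff_eq_zero_of_natDegree_lt (by omega)]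
            simp
          · have : q = m + 1 := by omega
            subst this
            have : (N * (X - C s)).coeff (m + 1) = 1 := by
              have := (hNm.mul (monic_X_sub_C s)).coeff_natDegree
              rwa [hd] at this
            rw [this, ← hc]; ring
        have e1 : divDiff (fun w => p.eval w) (l' ++ [t]) = (p - C c * (N * (X - C t))).coeff m := by
          rw [← ih (l' ++ [t]) _ (by simp [hl']) (List.nodup_cons.1 hnd).2 (key t)]
          apply divDiff_congr_s9 _ _ _ _ rfl
          intro w hw
          rcases List.mem_append.1 hw with h | h
          · simp [hNe w h]
          · rw [List.mem_singleton] at h; subst h; simp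
        have e2 : divDiff (fun w => p.eval w) (z :: l') = (p - C c * (N * (X - C z))).coeff m := by
          rw [← ih (z :: l') _ (by simp [hl']) (by
            rw [← List.cons_append] at hnd
            exact (List.nodup_append.1 hnd).1) (key z)]
          apply divDiff_congr_s9 _ _ _ _ rfl
          intro w hw
          rcases List.mem_cons.1 hw with h | h
          · subst h; simp
          · simp [hNe w h]
        rw [divDiff_snoc, e1, e2, ← coeff_sub]
        have : (p - C c * (N * (X - C t))) - (p - C c * (N * (X - C z))) = C (c * (t - z)) * N := by
          simp only [C_mul, C_sub]; ring
        rw [this, coeff_C_mul]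
        have : N.coeff m = 1 := by
          have := hNm.coeff_natDegree
          rwa [hNdeg] at this
        rw [this]
        field_simp

open Polynomial in
theorem core_interp (x : ℕ → ℝ) (n k : ℕ) (f : ℝ → ℝ) (c : ℕ → ℝ) (l : List ℝ) (t : ℝ)
    (hl : l.length = k + 1) (hnd : (l ++ [t]).Nodup)
    (hf : ∀ w ∈ l ++ [t], f w = ∑ j ∈ Finset.Icc 1 n, c j * fallFact x k j w)
    (hp : ∀ j ∈ Finset.Icc 1 n, ∃ p : ℝ[X], p.natDegree ≤ k ∧
      ∀ w ∈ l ++ [t], fallFact x k j w = p.eval w) :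
    divDiff f (l ++ [t]) = 0 ∧
      (∀ v : ℝ, divDiff (Function.update f t v) (l ++ [t]) = 0 → v = f t) := by
  have htl : t ∉ l := by
    intro h
    exact (List.nodup_append.1 hnd).2.2 t h t (by simp) rfl
  have h0 : divDiff f (l ++ [t]) = 0 := by
    choose! p hp1 hp2 using hp
    have hdeg : (∑ j ∈ Finset.Icc 1 n, C (c j) * p j).natDegree ≤ k := by
      apply Polynomial.natDegree_sum_le_of_forall_le
      intro j hj
      exact (Polynomial.natDegree_C_mul_le _ _).trans (hp1 j hj)
    have := divDiff_poly (k + 1) (l ++ [t]) (∑ j ∈ Finset.Icc 1 n, C (c j) * p j)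
      (by simp [hl]) hnd (by omega)
    rw [coeff_eq_zero_of_natDegree_lt (by omega)] at this
    rw [← this]
    apply divDiff_congr_s9 _ _ _ _ rfl
    intro w hw
    rw [hf w hw, Polynomial.eval_finsetSum]
    apply Finset.sum_congr rfl
    intro j hj
    rw [hp2 j hj w hw]; simp
  refine ⟨h0, fun v hv => ?_⟩
  have h1 := divDiff_sub_last (Function.update f t v) f t l (by
    intro w hw
    rw [Function.update_of_ne]
    rintro rfl
    exact htl hw)
  rw [hv, h0, Function.update_self, sub_zero, eq_comm, div_eq_zero_iff] at h1
  rcases h1 with h1 | h1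
  · linarith
  · rw [List.prod_eq_zero_iff, List.mem_map] at h1
    obtain ⟨w, hw, h⟩ := h1
    have : t = w := by linarith
    subst this
    exact absurd hw htl

theorem mem_ctrs (x : ℕ → ℝ) (lo hi : ℕ) (w : ℝ) :
    w ∈ ctrs x lo hi ↔ ∃ m, lo ≤ m ∧ m ≤ hi ∧ x m = w := by
  simp only [ctrs, List.mem_map, List.mem_range]
  constructor
  · rintro ⟨m, hm, rfl⟩
    exact ⟨lo + m, by omega, by omega, rfl⟩
  · rintro ⟨m, h1, h2, rfl⟩
    exact ⟨m - lo, by omega, by congr 1; omega⟩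

open Polynomial in
theorem prodPoly_deg (x : ℕ → ℝ) (s : Finset ℕ) (d : ℝ) (k : ℕ) (h : s.card ≤ k) :
    (C d * ∏ ℓ ∈ s, (X - C (x ℓ))).natDegree ≤ k := by
  refine (natDegree_C_mul_le _ _).trans ((natDegree_prod_le _ _).trans ?_)
  simpa using h

/-- Corollary: implicit interpolation formula for discrete splines.
Let `f ∈ H^k_n` and `t ∈ [a,b]` with `t ∉ {x_1,…,x_n}`.  Let `i` be the smallest index
with `x_i > t` (and `i = n` when `t > x_n`).  If `t > x_{k+1}` then
`f[x_{i−k},…,x_i,t] = 0`, and if `t < x_{k+1}` then `f[x_1,…,x_{k+1},t] = 0`.  In each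
case the equation, viewed as a linear equation in the single unknown `f(t)`, uniquely
determines `f(t)`: any value `v` put in place of `f(t)` making the divided difference
vanish must equal `f(t)`. -/
theorem implicit_interpolation
    (n k : ℕ) (a b : ℝ) (x : ℕ → ℝ)
    (hn : k + 2 ≤ n)
    (hmono : ∀ i, 1 ≤ i → i < n → x i < x (i + 1))
    (ha : a ≤ x 1) (hb : x n ≤ b) (hab : x (n + 1) = b)
    (f : ℝ → ℝ) (hf : inFFSpan x n k a b f)
    (t : ℝ) (ht : t ∈ Set.Icc a b) (htx : ∀ j ∈ Finset.Icc 1 n, t ≠ x j)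
    (i : ℕ) (hi : i ∈ Finset.Icc 1 n)
    (hi2 : (∀ j ∈ Finset.Icc 1 n, (t < x j ↔ i ≤ j)) ∨ (x n < t ∧ i = n)) :
    (x (k + 1) < t →
      divDiff f (ctrs x (i - k) i ++ [t]) = 0 ∧
      (∀ v : ℝ, divDiff (Function.update f t v) (ctrs x (i - k) i ++ [t]) = 0 → v = f t)) ∧
    (t < x (k + 1) →
      divDiff f (ctrs x 1 (k + 1) ++ [t]) = 0 ∧
      (∀ v : ℝ, divDiff (Function.update f t v) (ctrs x 1 (k + 1) ++ [t]) = 0 → v = f t)) := by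
  have hlt : ∀ p q, 1 ≤ p → p < q → q ≤ n → x p < x q := by
    intro p q hp hpq
    induction q, hpq using Nat.le_induction with
    | base => intro h; exact hmono p hp (by omega)
    | succ q hq ih => intro h; exact (ih (by omega)).trans (hmono q (by omega) (by omega))
  have hle : ∀ p q, 1 ≤ p → p ≤ q → q ≤ n → x p ≤ x q := by
    intro p q hp hpq hq
    rcases Nat.eq_or_lt_of_le hpq with rfl | h
    · exact le_rfl
    · exact (hlt p q hp h hq).le
  obtain ⟨c, hc⟩ := hf
  have main : ∀ lo hi, 1 ≤ lo → hi = lo + k → hi ≤ n →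
      (∀ j, k + 2 ≤ j → j ≤ n → 
        (hi ≤ j - 1 ∧ t < x (j - 1)) ∨ (j - k ≤ lo ∧ x (j - 1) < t)) →
      divDiff f (ctrs x lo hi ++ [t]) = 0 ∧
      (∀ v : ℝ, divDiff (Function.update f t v) (ctrs x lo hi ++ [t]) = 0 → v = f t) := by
    intro lo hi hlo hhi hhn hj
    apply core_interp x n k f c
    · simp only [ctrs, List.length_map, List.length_range]; omega
    · rw [List.nodup_append]
      refine ⟨?_, by simp, ?_⟩
      · rw [ctrs]
        apply List.Nodup.map_on _ List.nodup_range
        intro p hp q hq hpq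
        rw [List.mem_range] at hp hq
        rcases lt_trichotomy p q with h | h | h
        · exact absurd hpq (hlt _ _ (by omega) (by omega) (by omega)).ne
        · exact h
        · exact absurd hpq (hlt _ _ (by omega) (by omega) (by omega)).ne'
      · intro w hw w' hw' h
        rw [List.mem_singleton] at hw'
        obtain ⟨m, h1, h2, rfl⟩ := (mem_ctrs _ _ _ _).1 hw
        exact htx m (Finset.mem_Icc.2 ⟨by omega, by omega⟩) (by rw [h, hw'])
    · intro w hw
      apply hc
      rcases List.mem_append.1 hw with h | h
      · obtain ⟨m, h1, h2, rfl⟩ := (mem_ctrs _ _ _ _).1 h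
        exact ⟨ha.trans (hle 1 m le_rfl (by omega) (by omega)),
          (hle m n (by omega) (by omega) le_rfl).trans hb⟩
      · rw [List.mem_singleton] at h; rwa [h]
    · intro j hjn
      rw [Finset.mem_Icc] at hjn
      by_cases hjk : j ≤ k + 1
      · refine ⟨Polynomial.C (1 / (Nat.factorial (j - 1) : ℝ)) *
          ∏ ℓ ∈ Finset.Icc 1 (j - 1), (Polynomial.X - Polynomial.C (x ℓ)),
          prodPoly_deg _ _ _ _ (by simp; omega), ?_⟩
        intro w _
        rw [fallFact, if_pos hjk]
        simp [Polynomial.eval_prod]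
      · rcases hj j (by omega) hjn.2 with ⟨h1, h2⟩ | ⟨h1, h2⟩
        · refine ⟨0, by simp, ?_⟩
          intro w hw
          have : ¬ x (j - 1) < w := by
            rcases List.mem_append.1 hw with h | h
            · obtain ⟨m, h3, h4, rfl⟩ := (mem_ctrs _ _ _ _).1 h
              exact not_lt.2 (hle _ _ (by omega) (by omega) (by omega))
            · rw [List.mem_singleton] at h; rw [h]; exact not_lt.2 h2.le
          rw [fallFact, if_neg hjk, if_neg this]
          simp
        · refine ⟨Polynomial.C (1 / (Nat.factorial k : ℝ)) *
            ∏ ℓ ∈ Finset.Icc (j - k) (j - 1), (Polynomial.X - Polynomial.C (x ℓ)),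
            prodPoly_deg _ _ _ _ (by simp; omega), ?_⟩
          intro w hw
          rw [fallFact, if_neg hjk]
          by_cases hxw : x (j - 1) < w
          · rw [if_pos hxw]; simp [Polynomial.eval_prod]
          · rcases List.mem_append.1 hw with h | h
            · obtain ⟨m, h3, h4, rfl⟩ := (mem_ctrs _ _ _ _).1 h
              have hm : m ≤ j - 1 := by
                by_contra hcon
                exact hxw (hlt _ _ (by omega) (by omega) (by omega))
              have hz : ∏ ℓ ∈ Finset.Icc (j - k) (j - 1), (x m - x ℓ) = 0 :=
                Finset.prod_eq_zero (i := m) (Finset.mem_Icc.2 ⟨by omega, hm⟩) (by simp)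
              simp [Polynomial.eval_prod, hz]
            · rw [List.mem_singleton] at h; rw [h] at hxw; exact absurd h2 hxw
  rw [Finset.mem_Icc] at hi
  constructor
  · intro hk
    rcases hi2 with hi2 | ⟨h1, h2⟩
    · have hik : k + 2 ≤ i := by
        by_contra hcon
        have := (hi2 (k + 1) (Finset.mem_Icc.2 ⟨by omega, by omega⟩)).2 (by omega)
        linarith
      apply main (i - k) i (by omega) (by omega) hi.2
      intro j hj hjn
      have hm : j - 1 ∈ Finset.Icc 1 n := Finset.mem_Icc.2 ⟨by omega, by omega⟩
      rcases Nat.lt_or_ge (j - 1) i with h | h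
      · right
        refine ⟨by omega, lt_of_le_of_ne (not_lt.1 fun hh => ?_) (htx _ hm).symm⟩
        have := (hi2 _ hm).1 hh
        omega
      · left
        exact ⟨h, (hi2 _ hm).2 h⟩
    · subst h2
      apply main (i - k) i (by omega) (by omega) hi.2
      intro j hj hjn
      right
      exact ⟨by omega, (hle _ _ (by omega) (by omega) le_rfl).trans_lt h1⟩
  · intro hk
    apply main 1 (k + 1) le_rfl (by omega) (by omega)
    intro j hj hjn
    left
    exact ⟨by omega, hk.trans_le (hle _ _ (by omega) (by omega) (by omega))⟩
end
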